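/- (1) There is a one-to-one correspondence between isomorphism classes of regular Courant algebroids and equivalence classes of characteristic pairs: the map 𝔦 sending the class of a characteristic pair (𝒜,C) to the isomorphism class of the standard Courant algebroid E^s(𝒜;C,κ) (for any hoist κ making C κ-coherent) is well defined and bijective, with inverse sending the class of a regular Courant algebroid E to the class of (𝒜^s, C^s) obtained from any dissection of E. (2) If E is a regular Courant algebroid corresponding to the characteristic pair (𝒜,C), then the characteristic class of E equals [C] ∈ H³(𝒜). -/

import Mathlib

/-! # Statement 18
(1) There is a one-to-one correspondence between isomorphism classes of regular Courant
algebroids and equivalence classes of characteristic pairs `(𝒜,C)`: the map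
`𝔦 : [(𝒜,C)] ↦ [E^s(𝒜;C,κ)]` is well defined and injective (equivalence of pairs ⟺
isomorphism of the standard Courant algebroids) and surjective (every regular Courant
algebroid is isomorphic to some `E^s(𝒜;C,κ)`).
(2) If `E` corresponds to `(𝒜,C)` then the characteristic class of `E` equals
`[C] ∈ H³(𝒜)`.

Algebraic model: `A` plays the role of `C^∞(M)` and vector fields are
`Derivation ℝ A A`. -/

section CE
variable {V A : Type} [CommRing A]

/-- differential of a `1`-form -/
def dCE1 (act : V → A → A) (bk : V → V → V) (ω : V → A) (x₀ x₁ : V) : A :=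
  act x₀ (ω x₁) - act x₁ (ω x₀) - ω (bk x₀ x₁)

/-- differential of a `2`-form -/
def dCE2 (act : V → A → A) (bk : V → V → V) (ω : V → V → A) (x₀ x₁ x₂ : V) : A :=
  act x₀ (ω x₁ x₂) - act x₁ (ω x₀ x₂) + act x₂ (ω x₀ x₁)
    - ω (bk x₀ x₁) x₂ + ω (bk x₀ x₂) x₁ - ω (bk x₁ x₂) x₀

/-- differential of a `3`-form -/
def dCE3 (act : V → A → A) (bk : V → V → V) (ω : V → V → V → A)
    (x₀ x₁ x₂ x₃ : V) : A :=
  act x₀ (ω x₁ x₂ x₃) - act x₁ (ω x₀ x₂ x₃) + act x₂ (ω x₀ x₁ x₃)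
    - act x₃ (ω x₀ x₁ x₂)
    - ω (bk x₀ x₁) x₂ x₃ + ω (bk x₀ x₂) x₁ x₃ - ω (bk x₀ x₃) x₁ x₂
    - ω (bk x₁ x₂) x₀ x₃ + ω (bk x₁ x₃) x₀ x₂ - ω (bk x₂ x₃) x₀ x₁

/-- differential of a `4`-form -/
def dCE4 (act : V → A → A) (bk : V → V → V) (ω : V → V → V → V → A)
    (x₀ x₁ x₂ x₃ x₄ : V) : A :=
  act x₀ (ω x₁ x₂ x₃ x₄) - act x₁ (ω x₀ x₂ x₃ x₄) + act x₂ (ω x₀ x₁ x₃ x₄)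
    - act x₃ (ω x₀ x₁ x₂ x₄) + act x₄ (ω x₀ x₁ x₂ x₃)
    - ω (bk x₀ x₁) x₂ x₃ x₄ + ω (bk x₀ x₂) x₁ x₃ x₄ - ω (bk x₀ x₃) x₁ x₂ x₄
    + ω (bk x₀ x₄) x₁ x₂ x₃
    - ω (bk x₁ x₂) x₀ x₃ x₄ + ω (bk x₁ x₃) x₀ x₂ x₄ - ω (bk x₁ x₄) x₀ x₂ x₃
    - ω (bk x₂ x₃) x₀ x₁ x₄ + ω (bk x₂ x₄) x₀ x₁ x₃
    - ω (bk x₃ x₄) x₀ x₁ x₂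

end CE

/-- A Courant algebroid (in algebraic form). -/
structure CourantAlgebroid (A : Type) [CommRing A] [Algebra ℝ A]
    (E : Type) [AddCommGroup E] [Module A E] [Module ℝ E] [IsScalarTower ℝ A E] where
  /-- the pseudo-metric `⟨-,-⟩` -/
  ip : E →ₗ[A] E →ₗ[A] A
  /-- the anchor `ρ` -/
  rho : E →ₗ[A] Derivation ℝ A A
  /-- the Dorfman bracket `∘` (ℝ-bilinear) -/
  dorf : E →ₗ[ℝ] E →ₗ[ℝ] E
  /-- the map `𝒟 : C^∞(M) → Γ(E)` -/
  Dmap : A → E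
  ip_symm : ∀ e₁ e₂, ip e₁ e₂ = ip e₂ e₁
  /-- fiberwise nondegeneracy of the pseudo-metric: `Ξ : E → E*` is bijective -/
  ip_nondeg : Function.Bijective fun e => ip e
  /-- `⟨𝒟f, e⟩ = ½ ρ(e) f` -/
  ip_D : ∀ (f : A) (e : E), (2 : A) * ip (Dmap f) e = rho e f
  /-- `ρ ∘ 𝒟 = 0` -/
  rho_D : ∀ f : A, rho (Dmap f) = 0
  dorf_jacobi : ∀ e₁ e₂ e₃,
    dorf e₁ (dorf e₂ e₃) = dorf (dorf e₁ e₂) e₃ + dorf e₂ (dorf e₁ e₃)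
  rho_dorf : ∀ e₁ e₂, rho (dorf e₁ e₂) = ⁅rho e₁, rho e₂⁆
  dorf_leibniz : ∀ (e₁ : E) (f : A) (e₂ : E),
    dorf e₁ (f • e₂) = rho e₁ f • e₂ + f • dorf e₁ e₂
  dorf_sym : ∀ e₁ e₂, dorf e₁ e₂ + dorf e₂ e₁ = (2 : ℝ) • Dmap (ip e₁ e₂)
  dorf_D : ∀ (f : A) (e : E), dorf (Dmap f) e = 0
  rho_ip : ∀ e₁ e₂ e₃,
    rho e₁ (ip e₂ e₃) = ip (dorf e₁ e₂) e₃ + ip e₂ (dorf e₁ e₃)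

namespace CourantAlgebroid

variable {A : Type} [CommRing A] [Algebra ℝ A]
variable {E : Type} [AddCommGroup E] [Module A E] [Module ℝ E] [IsScalarTower ℝ A E]
variable (ca : CourantAlgebroid A E)

/-- `(ker ρ)⊥`, the subbundle of `E` orthogonal to `ker ρ` w.r.t. the pseudo-metric. -/
def perp : Submodule A E where
  carrier := {e | ∀ k ∈ LinearMap.ker ca.rho, ca.ip e k = 0}
  add_mem' := by
    intro a b ha hb k hk
    simp [map_add, ha k hk, hb k hk]
  zero_mem' := by intro k hk; simp
  smul_mem' := by
    intro c x hx k hk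
    simp [map_smul, hx k hk]

/-- Regularity (constant rank of the anchor), expressed by the splitting of the two
canonical short exact sequences `0 → ker ρ → E → F → 0` and
`0 → (ker ρ)⊥ → ker ρ → 𝒢 → 0`. -/
def IsRegular : Prop :=
  (∃ lam : ↥(LinearMap.range ca.rho) →ₗ[A] E, ∀ x, ca.rho (lam x) = ↑x) ∧
  (∃ sig : (↥(LinearMap.ker ca.rho) ⧸
        (ca.perp.comap (LinearMap.ker ca.rho).subtype)) →ₗ[A] ↥(LinearMap.ker ca.rho),
      ∀ g, (ca.perp.comap (LinearMap.ker ca.rho).subtype).mkQ (sig g) = g)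

lemma dorf_mem_ker {r s : E} (hr : r ∈ LinearMap.ker ca.rho)
    (hs : s ∈ LinearMap.ker ca.rho) : ca.dorf r s ∈ LinearMap.ker ca.rho := by
  rw [LinearMap.mem_ker] at *
  rw [ca.rho_dorf, hr, hs, zero_lie]

lemma dorf_ker_left_mem_ker (e : E) {r : E} (hr : r ∈ LinearMap.ker ca.rho) :
    ca.dorf e r ∈ LinearMap.ker ca.rho := by
  rw [LinearMap.mem_ker] at *
  rw [ca.rho_dorf, hr, lie_zero]

/-- sections of `ker ρ` -/
abbrev Ker := ↥(LinearMap.ker ca.rho)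

/-- `(ker ρ)⊥` viewed inside `ker ρ` -/
abbrev perp' : Submodule A ca.Ker := ca.perp.comap (LinearMap.ker ca.rho).subtype

/-- `𝒢 := ker ρ/(ker ρ)⊥` -/
abbrev Gq := ca.Ker ⧸ ca.perp'

/-- the projection `π : ker ρ → 𝒢` -/
abbrev piG : ca.Ker →ₗ[A] ca.Gq := ca.perp'.mkQ

/-- the ample quotient `𝒜_E := E/(ker ρ)⊥` -/
abbrev Ample := E ⧸ ca.perp

/-- the projection `q : E → 𝒜_E` -/
abbrev qA : E →ₗ[A] ca.Ample := ca.perp.mkQ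

/-- Dorfman bracket of two sections of `ker ρ`, viewed in `ker ρ`. -/
def dorfK (r s : ca.Ker) : ca.Ker := ⟨ca.dorf ↑r ↑s, ca.dorf_mem_ker r.2 s.2⟩

/-- Dorfman bracket of a section of `E` with a section of `ker ρ`, viewed in `ker ρ`. -/
def dorfEK (e : E) (r : ca.Ker) : ca.Ker := ⟨ca.dorf e ↑r, ca.dorf_ker_left_mem_ker e r.2⟩

end CourantAlgebroid

section StandardCA

variable {A : Type} [CommRing A] [Algebra ℝ A]
variable (F : Submodule A (Derivation ℝ A A))
variable {G : Type} [AddCommGroup G] [Module A G] [Module ℝ G] [IsScalarTower ℝ A G]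

/-- the leafwise Lie bracket on the integrable subbundle `F` -/
def fbk (hF : ∀ x y : ↥F, ⁅(x : Derivation ℝ A A), (y : Derivation ℝ A A)⁆ ∈ F)
    (x y : ↥F) : ↥F :=
  ⟨⁅(x : Derivation ℝ A A), (y : Derivation ℝ A A)⁆, hF x y⟩

/-- the action of vector fields tangent to `F` on functions -/
def fact (x : ↥F) (f : A) : A := (x : Derivation ℝ A A) f

/-- A standard Courant algebroid structure on `F*⊕𝒢⊕F`: the anchor is the projection
onto `F`, the pseudo-metric is `½⟨ξ₁,x₂⟩ + ½⟨ξ₂,x₁⟩ + ⟨r₁,r₂⟩_𝒢`, and the 𝒢-component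
of the Dorfman bracket of sections of 𝒢 is the fiberwise bracket `[-,-]_𝒢`. -/
def IsStandardCA (lG : G → G → G) (ipG : G → G → A)
    (ca : CourantAlgebroid A (Module.Dual A ↥F × G × ↥F)) : Prop :=
  (∀ p, ca.rho p = ↑p.2.2) ∧
  (∀ p q, ca.ip p q =
    (2:ℝ)⁻¹ • p.1 q.2.2 + (2:ℝ)⁻¹ • q.1 p.2.2 + ipG p.2.1 q.2.1) ∧
  (∀ r s : G, (ca.dorf (0, r, 0) (0, s, 0)).2.1 = lG r s)

variable (ca : CourantAlgebroid A (Module.Dual A ↥F × G × ↥F))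

/-- the `F`-connection `∇` on `𝒢` induced by a standard Courant algebroid -/
def sNabla (x : ↥F) (r : G) : G := (ca.dorf (0, 0, x) (0, r, 0)).2.1

/-- the curvature-type bundle map `R : ∧²F → 𝒢` induced by a standard Courant algebroid -/
def sR (x y : ↥F) : G := (ca.dorf (0, 0, x) (0, 0, y)).2.1

/-- the 3-form `ℋ ∈ Γ(∧³F*)` induced by a standard Courant algebroid -/
def sH (x y z : ↥F) : A := (ca.dorf (0, 0, x) (0, 0, y)).1 z

/-- the 4-form `⟨R∧R⟩` on `F` -/
noncomputable def pontR (ipG : G → G → A) (Rm : ↥F → ↥F → G)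
    (x₁ x₂ x₃ x₄ : ↥F) : A :=
  (4:ℝ)⁻¹ • ∑ σ : Equiv.Perm (Fin 4),
    (Equiv.Perm.sign σ : ℤ) •
      ipG (Rm (![x₁, x₂, x₃, x₄] (σ 0)) (![x₁, x₂, x₃, x₄] (σ 1)))
          (Rm (![x₁, x₂, x₃, x₄] (σ 2)) (![x₁, x₂, x₃, x₄] (σ 3)))

end StandardCA

/-- A quadratic Lie algebroid (in algebraic form): a Lie algebroid over `A` (playing the
role of `C^∞(M)`) together with a fiberwise nondegenerate ad-invariant symmetric bilinear
form on the kernel of the anchor (here given as a symmetric bilinear form on `L`,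
only its restriction to `ker a` being relevant). -/
structure QuadLieAlgebroid (A : Type) [CommRing A] [Algebra ℝ A]
    (L : Type) [AddCommGroup L] [Module A L] [Module ℝ L] [IsScalarTower ℝ A L] where
  /-- the anchor `a` -/
  anchor : L →ₗ[A] Derivation ℝ A A
  /-- the Lie bracket (ℝ-bilinear) -/
  bracket : L →ₗ[ℝ] L →ₗ[ℝ] L
  bracket_skew : ∀ X Y, bracket X Y = - bracket Y X
  jacobi : ∀ X Y Z,
    bracket X (bracket Y Z) = bracket (bracket X Y) Z + bracket Y (bracket X Z)
  leibniz : ∀ (X : L) (f : A) (Y : L),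
    bracket X (f • Y) = f • bracket X Y + anchor X f • Y
  anchor_bracket : ∀ X Y, anchor (bracket X Y) = ⁅anchor X, anchor Y⁆
  /-- the pairing `⟨-,-⟩_𝒢` on `𝒢 = ker a` -/
  ipG : L →ₗ[A] L →ₗ[A] A
  ipG_symm : ∀ r s, ipG r s = ipG s r
  ipG_nondeg : ∀ r ∈ LinearMap.ker anchor,
    (∀ s ∈ LinearMap.ker anchor, ipG r s = 0) → r = 0
  /-- `a(X)⟨r,s⟩_𝒢 = ⟨[X,r],s⟩_𝒢 + ⟨r,[X,s]⟩_𝒢` (for `X ∈ ker a` this is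
  ad-invariance of the fiberwise pairing) -/
  ipG_inv : ∀ (X r s : L), r ∈ LinearMap.ker anchor → s ∈ LinearMap.ker anchor →
    anchor X (ipG r s) = ipG (bracket X r) s + ipG r (bracket X s)

namespace QuadLieAlgebroid

variable {A : Type} [CommRing A] [Algebra ℝ A]
variable {L : Type} [AddCommGroup L] [Module A L] [Module ℝ L] [IsScalarTower ℝ A L]
variable (Q : QuadLieAlgebroid A L)

/-- `F := a(𝒜)`, the characteristic distribution. -/
abbrev Fq : Submodule A (Derivation ℝ A A) := LinearMap.range Q.anchor

/-- `𝒢 := ker a`. -/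
abbrev Kq : Submodule A L := LinearMap.ker Q.anchor

lemma lie_mem_range (x y : ↥Q.Fq) :
    ⁅(x : Derivation ℝ A A), (y : Derivation ℝ A A)⁆ ∈ Q.Fq := by
  obtain ⟨X, hX⟩ := x.2
  obtain ⟨Y, hY⟩ := y.2
  exact ⟨Q.bracket X Y, by rw [Q.anchor_bracket, hX, hY]⟩

/-- the (leafwise) Lie bracket of vector fields tangent to `F` -/
def fbk (x y : ↥Q.Fq) : ↥Q.Fq :=
  ⟨⁅(x : Derivation ℝ A A), (y : Derivation ℝ A A)⁆, Q.lie_mem_range x y⟩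

/-- the action of vector fields tangent to `F` on functions -/
def fact (x : ↥Q.Fq) (f : A) : A := (x : Derivation ℝ A A) f

lemma bracket_mem_ker (X : L) {r : L} (hr : r ∈ Q.Kq) : Q.bracket X r ∈ Q.Kq := by
  have h : Q.anchor (Q.bracket X r) = ⁅Q.anchor X, Q.anchor r⁆ := Q.anchor_bracket X r
  rw [LinearMap.mem_ker] at hr ⊢
  rw [h, hr, lie_zero]

/-- A hoist of `𝒜`: a section `κ : F → 𝒜` of the anchor. -/
structure Hoist where
  toFun : ↥Q.Fq →ₗ[A] L
  sect : ∀ x, Q.anchor (toFun x) = ↑x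

variable {Q}

/-- The curvature `R^κ(x,y) = [κ(x),κ(y)] − κ([x,y])` of a hoist. -/
def Hoist.curv (κ : Q.Hoist) (x y : ↥Q.Fq) : L :=
  Q.bracket (κ.toFun x) (κ.toFun y) - κ.toFun (Q.fbk x y)

lemma Hoist.curv_mem_ker (κ : Q.Hoist) (x y : ↥Q.Fq) : κ.curv x y ∈ Q.Kq := by
  rw [LinearMap.mem_ker, Hoist.curv, map_sub, Q.anchor_bracket, κ.sect, κ.sect, κ.sect]
  show ⁅(x : Derivation ℝ A A), (y : Derivation ℝ A A)⁆ - ↑(Q.fbk x y) = 0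
  rw [fbk]
  exact sub_self _

variable (Q)

/-- The 4-form `⟨R^κ∧R^κ⟩` representing the first Pontryagin class. -/
noncomputable def pont4 (κ : Q.Hoist) (x₁ x₂ x₃ x₄ : ↥Q.Fq) : A :=
  (4:ℝ)⁻¹ • ∑ σ : Equiv.Perm (Fin 4),
    (Equiv.Perm.sign σ : ℤ) •
      Q.ipG (κ.curv (![x₁, x₂, x₃, x₄] (σ 0)) (![x₁, x₂, x₃, x₄] (σ 1)))
            (κ.curv (![x₁, x₂, x₃, x₄] (σ 2)) (![x₁, x₂, x₃, x₄] (σ 3)))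

end QuadLieAlgebroid

namespace QuadLieAlgebroid

variable {A : Type} [CommRing A] [Algebra ℝ A]
variable {L : Type} [AddCommGroup L] [Module A L] [Module ℝ L] [IsScalarTower ℝ A L]
variable {Q : QuadLieAlgebroid A L}

/-- the fiberwise Lie bracket on `𝒢 = ker a` -/
def lGk (r s : ↥Q.Kq) : ↥Q.Kq := ⟨Q.bracket ↑r ↑s, Q.bracket_mem_ker _ s.2⟩

/-- the connection `∇^κ_x r = [κ(x), r]` induced by a hoist -/
def Hoist.nabla (κ : Q.Hoist) (x : ↥Q.Fq) (r : ↥Q.Kq) : ↥Q.Kq :=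
  ⟨Q.bracket (κ.toFun x) ↑r, Q.bracket_mem_ker _ r.2⟩

/-- the curvature `R^κ` viewed with values in `𝒢 = ker a` -/
def Hoist.curvK (κ : Q.Hoist) (x y : ↥Q.Fq) : ↥Q.Kq := ⟨κ.curv x y, κ.curv_mem_ker x y⟩

/-- modification `κ − J` of a hoist `κ` by a bundle map `J : F → 𝒢` -/
def Hoist.sub (κ : Q.Hoist) (J : ↥Q.Fq →ₗ[A] ↥Q.Kq) : Q.Hoist where
  toFun := κ.toFun - Q.Kq.subtype.comp J
  sect := by
    intro x
    have hJ : Q.anchor ↑(J x) = 0 := by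
      have := (J x).2
      rwa [LinearMap.mem_ker] at this
    simp only [LinearMap.sub_apply, map_sub, LinearMap.comp_apply, Submodule.coe_subtype]
    rw [κ.sect, hJ, sub_zero]

end QuadLieAlgebroid

open QuadLieAlgebroid in
/-- A closed 3-form on a quadratic Lie algebroid which is coherent with respect to the
hoist `κ`. -/
def IsKCoherent
    {A : Type} [CommRing A] [Algebra ℝ A]
    {L : Type} [AddCommGroup L] [Module A L] [Module ℝ L] [IsScalarTower ℝ A L]
    (Q : QuadLieAlgebroid A L) (C : L → L → L → A) (κ : Q.Hoist) : Prop :=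
  (∀ (f : A) X X' Y Z, C (f • X + X') Y Z = f * C X Y Z + C X' Y Z) ∧
  (∀ X Y Z, C X Y Z = - C Y X Z) ∧
  (∀ X Y Z, C X Y Z = - C X Z Y) ∧
  (∀ X₀ X₁ X₂ X₃,
    dCE3 (fun X f => Q.anchor X f) (fun X Y => Q.bracket X Y) C X₀ X₁ X₂ X₃ = 0) ∧
  (∀ r s t, r ∈ Q.Kq → s ∈ Q.Kq → t ∈ Q.Kq → C r s t = - Q.ipG (Q.bracket r s) t) ∧
  (∀ r s, r ∈ Q.Kq → s ∈ Q.Kq → ∀ x, C r s (κ.toFun x) = 0) ∧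
  (∀ r, r ∈ Q.Kq → ∀ x y, C r (κ.toFun x) (κ.toFun y) = Q.ipG r (κ.curv x y))

open QuadLieAlgebroid in
/-- `ca` is (a realization of) the standard Courant algebroid `E^s(𝒜;C,κ)` on
`F*⊕𝒢⊕F` determined by the quintuple `(F,𝒢;∇^κ,R^κ,ℋ^{(C,κ)})`, where
`ℋ^{(C,κ)}(x,y,z) = C(κ(x),κ(y),κ(z))`. -/
def RealizesES
    {A : Type} [CommRing A] [Algebra ℝ A]
    {L : Type} [AddCommGroup L] [Module A L] [Module ℝ L] [IsScalarTower ℝ A L]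
    (Q : QuadLieAlgebroid A L) (C : L → L → L → A) (κ : Q.Hoist)
    (ca : CourantAlgebroid A (Module.Dual A ↥Q.Fq × ↥Q.Kq × ↥Q.Fq)) : Prop :=
  IsStandardCA Q.Fq (fun r s => lGk r s) (fun r s => Q.ipG ↑r ↑s) ca ∧
  (∀ x r, sNabla Q.Fq ca x r = κ.nabla x r) ∧
  (∀ x y, sR Q.Fq ca x y = κ.curvK x y) ∧
  (∀ x y z, sH Q.Fq ca x y z = C (κ.toFun x) (κ.toFun y) (κ.toFun z))

/-- isomorphism of Courant algebroids (over possibly different modules of sections) -/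
def CAIsomorphic {A : Type} [CommRing A] [Algebra ℝ A]
    {E₁ : Type} [AddCommGroup E₁] [Module A E₁] [Module ℝ E₁] [IsScalarTower ℝ A E₁]
    {E₂ : Type} [AddCommGroup E₂] [Module A E₂] [Module ℝ E₂] [IsScalarTower ℝ A E₂]
    (ca₁ : CourantAlgebroid A E₁) (ca₂ : CourantAlgebroid A E₂) : Prop :=
  ∃ Θ : E₁ ≃ₗ[A] E₂,
    (∀ p, ca₂.rho (Θ p) = ca₁.rho p) ∧
    (∀ p q, ca₂.ip (Θ p) (Θ q) = ca₁.ip p q) ∧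
    (∀ p q, Θ (ca₁.dorf p q) = ca₂.dorf (Θ p) (Θ q))

open QuadLieAlgebroid in
/-- equivalence of characteristic pairs: an isomorphism `σ` of quadratic Lie algebroids
with `[C₁ − σ*C₂] = 0 ∈ H³_↔(𝒜₁)`, i.e. `C₁ − σ*C₂ = dφ` for some 2-form `φ`
annihilated by all sections of `∧²𝒢₁`. -/
def PairsEquiv {A : Type} [CommRing A] [Algebra ℝ A]
    {L₁ : Type} [AddCommGroup L₁] [Module A L₁] [Module ℝ L₁] [IsScalarTower ℝ A L₁]
    {L₂ : Type} [AddCommGroup L₂] [Module A L₂] [Module ℝ L₂] [IsScalarTower ℝ A L₂]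
    (Q₁ : QuadLieAlgebroid A L₁) (C₁ : L₁ → L₁ → L₁ → A)
    (Q₂ : QuadLieAlgebroid A L₂) (C₂ : L₂ → L₂ → L₂ → A) : Prop :=
  ∃ σ : L₁ ≃ₗ[A] L₂,
    (∀ X, Q₂.anchor (σ X) = Q₁.anchor X) ∧
    (∀ X Y, σ (Q₁.bracket X Y) = Q₂.bracket (σ X) (σ Y)) ∧
    (∀ r s, r ∈ Q₁.Kq → s ∈ Q₁.Kq → Q₂.ipG (σ r) (σ s) = Q₁.ipG r s) ∧
    ∃ φ : L₁ → L₁ → A,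
      (∀ (f : A) X X' Y, φ (f • X + X') Y = f * φ X Y + φ X' Y) ∧
      (∀ X Y, φ X Y = - φ Y X) ∧
      (∀ r s, r ∈ Q₁.Kq → s ∈ Q₁.Kq → φ r s = 0) ∧
      (∀ X Y Z, C₁ X Y Z - C₂ (σ X) (σ Y) (σ Z)
        = dCE2 (fun X f => Q₁.anchor X f) (fun X Y => Q₁.bracket X Y) φ X Y Z)

variable {A : Type} [CommRing A] [Algebra ℝ A]

/-- The Courant bracket (skew-symmetrization of the Dorfman bracket). -/
noncomputable def courantBk {E : Type} [AddCommGroup E] [Module A E] [Module ℝ E]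
    [IsScalarTower ℝ A E] (ca : CourantAlgebroid A E) (e₁ e₂ : E) : E :=
  (2:ℝ)⁻¹ • (ca.dorf e₁ e₂ - ca.dorf e₂ e₁)

section Diss

variable (F : Submodule A (Derivation ℝ A A))
variable {G : Type} [AddCommGroup G] [Module A G] [Module ℝ G] [IsScalarTower ℝ A G]
variable {E : Type} [AddCommGroup E] [Module A E] [Module ℝ E] [IsScalarTower ℝ A E]

/-- A dissection of a regular Courant algebroid with characteristic distribution `F`
and bundle of quadratic Lie algebras `𝒢`. -/
structure Dissection (lG : G → G → G) (ipG : G → G → A)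
    (ca : CourantAlgebroid A E) where
  toEquiv : (Module.Dual A ↥F × G × ↥F) ≃ₗ[A] E
  metric : ∀ p q, ca.ip (toEquiv p) (toEquiv q) =
    (2:ℝ)⁻¹ • p.1 q.2.2 + (2:ℝ)⁻¹ • q.1 p.2.2 + ipG p.2.1 q.2.1
  anchor : ∀ p, ca.rho (toEquiv p) = ↑p.2.2
  gbracket : ∀ r s : G,
    (toEquiv.symm (ca.dorf (toEquiv (0, r, 0)) (toEquiv (0, s, 0)))).2.1 = lG r s

variable {F} {lG : G → G → G} {ipG : G → G → A} {ca : CourantAlgebroid A E}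

/-- `R(x,y) = pr_𝒢(x∘y)` induced by a dissection. -/
def Dissection.Rmap (d : Dissection F lG ipG ca) (x y : ↥F) : G :=
  (d.toEquiv.symm (ca.dorf (d.toEquiv (0, 0, x)) (d.toEquiv (0, 0, y)))).2.1

/-- `ℋ(x,y,z) = ⟨pr_{F*}(x∘y),z⟩` induced by a dissection. -/
def Dissection.Hmap (d : Dissection F lG ipG ca) (x y z : ↥F) : A :=
  (d.toEquiv.symm (ca.dorf (d.toEquiv (0, 0, x)) (d.toEquiv (0, 0, y)))).1 z

/-- The naive 3-cocycle `C_Ψ` associated to a dissection `Ψ`. -/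
def Dissection.Cform (d : Dissection F lG ipG ca) (e₁ e₂ e₃ : E) : A :=
  ipG (d.Rmap (d.toEquiv.symm e₁).2.2 (d.toEquiv.symm e₂).2.2) (d.toEquiv.symm e₃).2.1
  + ipG (d.Rmap (d.toEquiv.symm e₂).2.2 (d.toEquiv.symm e₃).2.2) (d.toEquiv.symm e₁).2.1
  + ipG (d.Rmap (d.toEquiv.symm e₃).2.2 (d.toEquiv.symm e₁).2.2) (d.toEquiv.symm e₂).2.1
  - ipG (lG (d.toEquiv.symm e₁).2.1 (d.toEquiv.symm e₂).2.1) (d.toEquiv.symm e₃).2.1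
  + d.Hmap (d.toEquiv.symm e₁).2.2 (d.toEquiv.symm e₂).2.2 (d.toEquiv.symm e₃).2.2

end Diss

open QuadLieAlgebroid in
/-- A characteristic pair `(𝒜,C)` (with hoist `κ`), a realization `ca'` of the
standard Courant algebroid `E^s(𝒜;C,κ)`, and an isomorphism of Courant algebroids
`E ≅ E^s(𝒜;C,κ)`. -/
structure CharRealization (A : Type) [CommRing A] [Algebra ℝ A]
    (E : Type) [AddCommGroup E] [Module A E] [Module ℝ E] [IsScalarTower ℝ A E]
    (ca : CourantAlgebroid A E) where
  L : Type
  [iAG : AddCommGroup L]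
  [iM : Module A L]
  [iMR : Module ℝ L]
  [iT : IsScalarTower ℝ A L]
  Q : QuadLieAlgebroid A L
  C : L → L → L → A
  κ : Q.Hoist
  coherent : IsKCoherent Q C κ
  ca' : CourantAlgebroid A (Module.Dual A ↥Q.Fq × ↥Q.Kq × ↥Q.Fq)
  realizes : RealizesES Q C κ ca'
  iso : CAIsomorphic ca ca'

/-! ### Halving in a real algebra -/

section Halving

variable {A : Type} [CommRing A] [Algebra ℝ A]

lemma two_mul_algebraMap_half : (2 : A) * algebraMap ℝ A 2⁻¹ = 1 := by
  rw [← map_ofNat (algebraMap ℝ A) 2, ← map_mul]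
  norm_num

lemma two_mul_inj {a b : A} (h : 2 * a = 2 * b) : a = b := by
  linear_combination algebraMap ℝ A 2⁻¹ * h - (a - b) * two_mul_algebraMap_half (A := A)

lemma two_mul_half_smul (a : A) : 2 * ((2 : ℝ)⁻¹ • a) = a := by
  rw [Algebra.smul_def]
  linear_combination a * two_mul_algebraMap_half (A := A)

end Halving

/-! ### Courant algebroids: pairings and the naive 3-form of an isotropic projector -/

namespace CourantAlgebroid

section Pairing

variable {A : Type} [CommRing A] [Algebra ℝ A]
variable {E : Type} [AddCommGroup E] [Module A E] [Module ℝ E] [IsScalarTower ℝ A E]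
variable (ca : CourantAlgebroid A E)

/-- The trilinear expression `⟨a ∘ b, c⟩`. -/
def tri (a b c : E) : A := ca.ip (ca.dorf a b) c

lemma tri_add₁ (a a' b c : E) : ca.tri (a + a') b c = ca.tri a b c + ca.tri a' b c := by
  simp [tri]

lemma tri_add₂ (a b b' c : E) : ca.tri a (b + b') c = ca.tri a b c + ca.tri a b' c := by
  simp [tri]

lemma tri_add₃ (a b c c' : E) : ca.tri a b (c + c') = ca.tri a b c + ca.tri a b c' := by
  simp [tri]

lemma tri_sub₁ (a a' b c : E) : ca.tri (a - a') b c = ca.tri a b c - ca.tri a' b c := by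
  simp [tri]

lemma tri_sub₂ (a b b' c : E) : ca.tri a (b - b') c = ca.tri a b c - ca.tri a b' c := by
  simp [tri]

lemma tri_sub₃ (a b c c' : E) : ca.tri a b (c - c') = ca.tri a b c - ca.tri a b c' := by
  simp [tri]

lemma tri_smul₃ (f : A) (a b c : E) : ca.tri a b (f • c) = f * ca.tri a b c := by
  simp [tri]

lemma tri_smul₂ (f : A) (a b c : E) :
    ca.tri a (f • b) c = f * ca.tri a b c + ca.rho a f * ca.ip b c := by
  simp [tri, ca.dorf_leibniz]
  ring

lemma two_smul_real (e : E) : (2 : ℝ) • e = (2 : A) • e := by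
  rw [← algebraMap_smul A (2 : ℝ) e, map_ofNat]

lemma tri_symm (a b c : E) : ca.tri a b c + ca.tri b a c = ca.rho c (ca.ip a b) := by
  rw [tri, tri, ← LinearMap.add_apply, ← map_add, ca.dorf_sym, two_smul_real (A := A),
    map_smul, LinearMap.smul_apply, smul_eq_mul, ca.ip_D]

lemma tri_inv (a b c : E) : ca.tri a b c + ca.tri a c b = ca.rho a (ca.ip b c) := by
  rw [ca.rho_ip, tri, tri, ca.ip_symm b]

lemma tri_smul₁ (f : A) (a b c : E) :
    ca.tri (f • a) b c = f * ca.tri a b c - ca.rho b f * ca.ip a c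
      + ca.rho c f * ca.ip a b := by
  have h₁ := ca.tri_symm (f • a) b c
  have h₂ := ca.tri_symm a b c
  rw [ca.tri_smul₂] at h₁
  simp only [map_smul, LinearMap.smul_apply, smul_eq_mul, Derivation.leibniz] at h₁
  linear_combination h₁ - f * h₂

lemma ip_ext {e e' : E} (h : ∀ u, ca.ip e u = ca.ip e' u) : e = e' :=
  ca.ip_nondeg.1 (LinearMap.ext h)

/-- The isomorphism `E* ≅ E` given by the pseudo-metric. -/
noncomputable def sharp : Module.Dual A E ≃ₗ[A] E :=
  (LinearEquiv.ofBijective ca.ip ca.ip_nondeg).symm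

@[simp]
lemma ip_sharp (f : Module.Dual A E) (u : E) : ca.ip (ca.sharp f) u = f u :=
  LinearMap.congr_fun
    (LinearEquiv.apply_symm_apply (LinearEquiv.ofBijective ca.ip ca.ip_nondeg) f) u

lemma mem_perp {e : E} : e ∈ ca.perp ↔ ∀ k, ca.rho k = 0 → ca.ip e k = 0 := Iff.rfl

lemma rho_eq_zero_of_ip_D {e : E} (h : ∀ f, ca.ip e (ca.Dmap f) = 0) : ca.rho e = 0 := by
  ext f
  rw [← ca.ip_D, ca.ip_symm, h]
  simp

lemma rho_of_mem_perp {e : E} (h : e ∈ ca.perp) : ca.rho e = 0 :=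
  ca.rho_eq_zero_of_ip_D fun f => h _ (ca.rho_D f)

lemma D_mem_perp (f : A) : ca.Dmap f ∈ ca.perp := fun k hk => by
  apply two_mul_inj
  rw [ca.ip_D, LinearMap.mem_ker.1 hk]
  simp

lemma dorf_right_mem_perp (e : E) {z : E} (hz : z ∈ ca.perp) : ca.dorf e z ∈ ca.perp := by
  intro k hk
  have h := ca.rho_ip e z k
  rw [hz k hk, hz _ (ca.dorf_ker_left_mem_ker e hk)] at h
  simpa using h.symm

lemma dorf_add_swap_mem_perp (e e' : E) : ca.dorf e e' + ca.dorf e' e ∈ ca.perp := by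
  rw [ca.dorf_sym, two_smul_real (A := A)]
  exact ca.perp.smul_mem _ (ca.D_mem_perp _)

lemma dorf_left_mem_perp {z : E} (e : E) (hz : z ∈ ca.perp) : ca.dorf z e ∈ ca.perp := by
  have h := ca.perp.sub_mem (ca.dorf_add_swap_mem_perp z e) (ca.dorf_right_mem_perp e hz)
  simpa using h

/-- `P = λ ∘ ρ` for an isotropic section `λ` of the anchor. -/
structure IsIsotropicProjector (P : E →ₗ[A] E) : Prop where
  rho_apply : ∀ e, ca.rho (P e) = ca.rho e
  apply_of_rho : ∀ e, ca.rho e = 0 → P e = 0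
  isotropic : ∀ e e', ca.ip (P e) (P e') = 0

/-- The naive 3-form of an isotropic projector. -/
def projForm (P : E →ₗ[A] E) (e₀ e₁ e₂ : E) : A :=
  ca.tri (P e₀) (P e₁) (e₂ - P e₂) - ca.ip (P (ca.dorf e₀ e₁)) (e₂ - P e₂)
  + (ca.tri (P e₁) (P e₂) (e₀ - P e₀) - ca.ip (P (ca.dorf e₁ e₂)) (e₀ - P e₀))
  + (ca.tri (P e₂) (P e₀) (e₁ - P e₁) - ca.ip (P (ca.dorf e₂ e₀)) (e₁ - P e₁))
  - ca.tri (e₀ - P e₀) (e₁ - P e₁) (e₂ - P e₂)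
  + 2 * ca.tri (P e₀) (P e₁) (P e₂)

/-- The 2-form `⟨J e₁, e₂⟩ - ⟨J e₂, e₁⟩`. -/
def skewForm (J : E →ₗ[A] E) (e₁ e₂ : E) : A := ca.ip (J e₁) e₂ - ca.ip (J e₂) e₁

namespace IsIsotropicProjector

variable {ca} {P : E →ₗ[A] E}

lemma rho_sub (hP : ca.IsIsotropicProjector P) (e : E) : ca.rho (e - P e) = 0 := by
  rw [map_sub, hP.rho_apply, sub_self]

lemma apply_apply (hP : ca.IsIsotropicProjector P) (e : E) : P (P e) = P e := by
  have h := hP.apply_of_rho _ (hP.rho_sub e)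
  rw [map_sub, sub_eq_zero] at h
  exact h.symm

lemma apply_eq (hP : ca.IsIsotropicProjector P) {e e' : E} (h : ca.rho e = ca.rho e') :
    P e = P e' := by
  rw [← sub_eq_zero, ← map_sub]
  exact hP.apply_of_rho _ (by rw [map_sub, h, sub_self])

lemma apply_dorf_swap (hP : ca.IsIsotropicProjector P) (e e' : E) :
    P (ca.dorf e e') = -P (ca.dorf e' e) := by
  rw [← map_neg]
  apply hP.apply_eq
  rw [map_neg, ca.rho_dorf, ca.rho_dorf, lie_skew]

lemma apply_dorf_smul_left (hP : ca.IsIsotropicProjector P) (f : A) (e e' : E) :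
    P (ca.dorf (f • e) e') = f • P (ca.dorf e e') - ca.rho e' f • P e := by
  rw [hP.apply_dorf_swap, ca.dorf_leibniz, map_add, map_smul, map_smul, hP.apply_dorf_swap e' e]
  module

lemma tri_swap_left (hP : ca.IsIsotropicProjector P) (a b c : E) :
    ca.tri (P a) (P b) c = -ca.tri (P b) (P a) c := by
  have h := ca.tri_symm (P a) (P b) c
  rw [hP.isotropic, map_zero] at h
  linear_combination h

lemma projForm_swap_left (hP : ca.IsIsotropicProjector P) (e₀ e₁ e₂ : E) :
    ca.projForm P e₀ e₁ e₂ = -ca.projForm P e₁ e₀ e₂ := by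
  have h := ca.tri_symm (e₀ - P e₀) (e₁ - P e₁) (e₂ - P e₂)
  rw [hP.rho_sub, Derivation.zero_apply] at h
  simp only [projForm]
  rw [hP.tri_swap_left e₀ e₁, hP.tri_swap_left e₁ e₂, hP.tri_swap_left e₂ e₀,
    hP.tri_swap_left e₀ e₁, hP.apply_dorf_swap e₀ e₁, hP.apply_dorf_swap e₁ e₂,
    hP.apply_dorf_swap e₂ e₀]
  simp only [map_neg, LinearMap.neg_apply]
  linear_combination -h

lemma projForm_cyclic (hP : ca.IsIsotropicProjector P) (e₀ e₁ e₂ : E) :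
    ca.projForm P e₀ e₁ e₂ = ca.projForm P e₁ e₂ e₀ := by
  have h₁ := ca.tri_symm (e₀ - P e₀) (e₁ - P e₁) (e₂ - P e₂)
  have h₂ := ca.tri_inv (e₁ - P e₁) (e₂ - P e₂) (e₀ - P e₀)
  have h₃ := ca.tri_inv (P e₁) (P e₂) (P e₀)
  rw [hP.rho_sub, Derivation.zero_apply] at h₁ h₂
  rw [hP.isotropic, map_zero] at h₃
  have h₄ := hP.tri_swap_left e₀ e₁ (P e₂)
  simp only [projForm]
  linear_combination h₂ - h₁ - 2 * h₃ + 2 * h₄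

lemma projForm_swap_right (hP : ca.IsIsotropicProjector P) (e₀ e₁ e₂ : E) :
    ca.projForm P e₀ e₁ e₂ = -ca.projForm P e₀ e₂ e₁ := by
  rw [hP.projForm_cyclic e₀ e₂ e₁, ← hP.projForm_swap_left, ← hP.projForm_cyclic]
  rw [hP.projForm_cyclic, hP.projForm_cyclic]

lemma _root_.CourantAlgebroid.projForm_add_left (a a' b c : E) :
    ca.projForm P (a + a') b c = ca.projForm P a b c + ca.projForm P a' b c := by
  simp only [projForm, map_add, LinearMap.add_apply, tri_add₁, tri_add₂, tri_add₃,
    tri_sub₁, tri_sub₂, tri_sub₃, map_sub]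
  ring

lemma projForm_smul_left (hP : ca.IsIsotropicProjector P) (f : A) (a b c : E) :
    ca.projForm P (f • a) b c = f * ca.projForm P a b c := by
  have h : f • a - f • P a = f • (a - P a) := by module
  simp only [projForm, map_smul, h, tri_smul₁, tri_smul₂, tri_smul₃, hP.apply_dorf_smul_left,
    ca.dorf_leibniz, map_add, hP.rho_sub, Derivation.zero_apply, hP.isotropic, map_smul,
    LinearMap.add_apply, LinearMap.smul_apply, smul_eq_mul, hP.rho_apply]
  simp only [map_sub, map_smul, LinearMap.sub_apply, LinearMap.smul_apply, smul_eq_mul,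
    hP.isotropic]
  ring

lemma projForm_of_mem_perp (hP : ca.IsIsotropicProjector P) {a : E} (ha : a ∈ ca.perp) (b c : E) :
    ca.projForm P a b c = 0 := by
  have h₀ : P a = 0 := hP.apply_of_rho _ (ca.rho_of_mem_perp ha)
  have h₁ : ca.tri a (b - P b) (c - P c) = 0 :=
    ca.dorf_left_mem_perp _ ha _ (hP.rho_sub c)
  have h₂ : P (ca.dorf a b) = 0 :=
    hP.apply_of_rho _ (ca.rho_of_mem_perp (ca.dorf_left_mem_perp _ ha))
  have h₃ : P (ca.dorf c a) = 0 :=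
    hP.apply_of_rho _ (ca.rho_of_mem_perp (ca.dorf_right_mem_perp _ ha))
  have h₄ : ca.tri (P b) (P c) a - ca.ip (P (ca.dorf b c)) a = 0 := by
    rw [tri, ← LinearMap.sub_apply, ← map_sub, ca.ip_symm]
    refine ha _ ?_
    rw [LinearMap.mem_ker, map_sub, ca.rho_dorf, hP.rho_apply, hP.rho_apply, hP.rho_apply,
      ca.rho_dorf, sub_self]
  have h₅ : ∀ x y, ca.tri 0 x y = 0 := fun x y => by simp [tri]
  have h₆ : ∀ x y, ca.tri x 0 y = 0 := fun x y => by simp [tri]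
  simp only [projForm, h₀, h₂, h₃, sub_zero, h₁, h₅, h₆, map_zero, LinearMap.zero_apply]
  linear_combination h₄

/-- The naive 3-form is `⟨a ∘ b, c⟩` up to sign and a coboundary. -/
lemma projForm_eq (hP : ca.IsIsotropicProjector P) (e₀ e₁ e₂ : E) :
    ca.projForm P e₀ e₁ e₂ =
      dCE2 (fun e f => ca.rho e f) (fun a b => ca.dorf a b) (ca.skewForm P) e₀ e₁ e₂
        - ca.tri e₀ e₁ e₂ := by
  obtain ⟨g₀, hg₀⟩ : ∃ g, e₀ = g + P e₀ := ⟨e₀ - P e₀, (sub_add_cancel _ _).symm⟩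
  obtain ⟨g₁, hg₁⟩ : ∃ g, e₁ = g + P e₁ := ⟨e₁ - P e₁, (sub_add_cancel _ _).symm⟩
  obtain ⟨g₂, hg₂⟩ : ∃ g, e₂ = g + P e₂ := ⟨e₂ - P e₂, (sub_add_cancel _ _).symm⟩
  have r₀ : ca.rho g₀ = 0 := by rw [← hP.rho_sub e₀, ← eq_sub_of_add_eq hg₀.symm]
  have r₁ : ca.rho g₁ = 0 := by rw [← hP.rho_sub e₁, ← eq_sub_of_add_eq hg₁.symm]
  have r₂ : ca.rho g₂ = 0 := by rw [← hP.rho_sub e₂, ← eq_sub_of_add_eq hg₂.symm]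
  have i₀₁ := hP.isotropic e₀ e₁
  have i₀₂ := hP.isotropic e₀ e₂
  have i₁₂ := hP.isotropic e₁ e₂
  have j₀ := hP.isotropic (ca.dorf e₁ e₂) e₀
  have j₁ := hP.isotropic (ca.dorf e₀ e₂) e₁
  have j₂ := hP.isotropic (ca.dorf e₀ e₁) e₂
  have k₀ : ∀ a b : E, ca.ip (P e₀) (ca.dorf a b) = ca.tri a b (P e₀) := fun _ _ => ca.ip_symm _ _
  have k₁ : ∀ a b : E, ca.ip (P e₁) (ca.dorf a b) = ca.tri a b (P e₁) := fun _ _ => ca.ip_symm _ _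
  have k₂ : ∀ a b : E, ca.ip (P e₂) (ca.dorf a b) = ca.tri a b (P e₂) := fun _ _ => ca.ip_symm _ _
  simp only [projForm, dCE2, skewForm, k₀, k₁, k₂, hP.apply_dorf_swap e₂ e₀]
  generalize P (ca.dorf e₀ e₁) = m₀₁ at *
  generalize P (ca.dorf e₀ e₂) = m₀₂ at *
  generalize P (ca.dorf e₁ e₂) = m₁₂ at *
  generalize P e₀ = p₀ at *
  generalize P e₁ = p₁ at *
  generalize P e₂ = p₂ at *
  subst hg₀ hg₁ hg₂
  have i₁₀ := i₀₁
  rw [ca.ip_symm] at i₁₀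
  have i₂₀ := i₀₂
  rw [ca.ip_symm] at i₂₀
  have i₂₁ := i₁₂
  rw [ca.ip_symm] at i₂₁
  simp only [add_sub_cancel_right, tri_add₁, tri_add₂, tri_add₃, map_add,
    map_neg, LinearMap.neg_apply, r₀, r₁, r₂,
    map_sub, j₀, j₁, j₂, i₀₁, i₀₂, i₁₂, i₁₀, i₂₀, i₂₁, add_zero, zero_add]
  have iv := fun a b c => ca.tri_inv a b c
  have sy := fun a b c => ca.tri_symm a b c
  have a1 := iv p₀ p₁ p₂
  have a2 := iv p₁ p₂ p₀
  have a3 := sy p₀ p₁ p₂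
  have b1 := iv p₀ g₂ p₁
  have b2 := iv p₁ g₂ p₀
  have b3 := sy p₀ p₁ g₂
  have c1 := iv p₀ g₁ p₂
  have c2 := iv p₂ p₀ g₁
  have c3 := sy p₀ p₂ g₁
  have c4 := sy g₁ p₂ p₀
  have c5 := iv g₁ p₀ p₂
  have c6 := sy g₁ p₀ p₂
  have d1 := iv p₁ p₂ g₀
  have d2 := sy p₁ g₀ p₂
  have d3 := iv g₀ p₁ p₂
  have e1 := iv g₀ g₂ p₁
  have f1 := sy g₁ p₀ g₂
  have f2 := iv g₁ g₂ p₀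
  simp only [r₀, r₁, r₂, Derivation.zero_apply, i₀₁, i₀₂, i₁₂, i₁₀, i₂₀, i₂₁, map_zero] at *
  have t1 := ca.ip_symm p₀ g₁
  have t2 := ca.ip_symm p₀ g₂
  have t3 := ca.ip_symm p₁ g₀
  have t4 := ca.ip_symm p₁ g₂
  have t5 := ca.ip_symm p₂ g₀
  have t6 := ca.ip_symm p₂ g₁
  rw [t1] at *
  rw [t2] at *
  rw [t3] at *
  rw [t4] at *
  rw [t5] at *
  rw [t6] at *
  grind

end IsIsotropicProjector

end Pairing

end CourantAlgebroid

namespace CourantAlgebroid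

section NaiveCocycle

variable {A : Type} [CommRing A] [Algebra ℝ A]
variable {E : Type} [AddCommGroup E] [Module A E] [Module ℝ E] [IsScalarTower ℝ A E]
variable {ca : CourantAlgebroid A E}

namespace IsIsotropicProjector

variable {P P' : E →ₗ[A] E}

/-- The naive 3-forms of two isotropic projectors differ by a coboundary. -/
lemma projForm_sub_projForm (hP : ca.IsIsotropicProjector P) (hP' : ca.IsIsotropicProjector P')
    (e₀ e₁ e₂ : E) :
    ca.projForm P' e₀ e₁ e₂ - ca.projForm P e₀ e₁ e₂ =
      dCE2 (fun e f => ca.rho e f) (fun a b => ca.dorf a b) (ca.skewForm (P' - P)) e₀ e₁ e₂ := by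
  have h : ca.skewForm (P' - P) = fun a b => ca.skewForm P' a b - ca.skewForm P a b := by
    funext a b
    simp only [skewForm, LinearMap.sub_apply, map_sub]
    ring
  rw [hP.projForm_eq, hP'.projForm_eq, h]
  simp only [dCE2, map_sub]
  ring

lemma dCE3_projForm (hP : ca.IsIsotropicProjector P) (x₀ x₁ x₂ x₃ : E) :
    dCE3 (fun e f => ca.rho e f) (fun a b => ca.dorf a b) (ca.projForm P) x₀ x₁ x₂ x₃ = 0 := by
  simp only [dCE3]
  rw [hP.projForm_swap_left (ca.dorf x₁ x₂) x₀ x₃, hP.projForm_swap_left (ca.dorf x₁ x₃) x₀ x₂,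
    hP.projForm_swap_left (ca.dorf x₂ x₃) x₀ x₁, hP.projForm_swap_right x₀ (ca.dorf x₂ x₃) x₁,
    hP.projForm_swap_left (ca.dorf x₀ x₂) x₁ x₃, hP.projForm_swap_left (ca.dorf x₀ x₃) x₁ x₂,
    hP.projForm_swap_right x₁ (ca.dorf x₀ x₃) x₂, hP.projForm_swap_right x₀ (ca.dorf x₁ x₃) x₂]
  have s := ca.tri_symm (ca.dorf x₀ x₁) x₂ x₃
  have add_left : ∀ a b c, ca.skewForm P (a + b) c = ca.skewForm P a c + ca.skewForm P b c := by
    intro a b c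
    simp only [skewForm, map_add, LinearMap.add_apply]
    ring
  have skew : ∀ a b, ca.skewForm P a b = -ca.skewForm P b a := by
    intro a b
    simp only [skewForm]
    ring
  simp only [hP.projForm_eq, dCE2, map_sub, map_add, ca.rho_dorf,
    Derivation.commutator_apply, ca.dorf_jacobi x₀ x₁ x₂, ca.dorf_jacobi x₀ x₁ x₃,
    ca.dorf_jacobi x₀ x₂ x₃, ca.dorf_jacobi x₁ x₂ x₃, add_left, tri, ca.rho_ip,
    LinearMap.add_apply] at s ⊢
  have t := skew (ca.dorf x₀ x₁) (ca.dorf x₂ x₃)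
  have t' := skew (ca.dorf x₀ x₂) (ca.dorf x₁ x₃)
  have t'' := skew (ca.dorf x₀ x₃) (ca.dorf x₁ x₂)
  rw [skew x₀ (ca.dorf x₁ x₂), skew x₀ (ca.dorf x₁ x₃), skew x₀ (ca.dorf x₂ x₃),
    skew x₁ (ca.dorf x₀ x₂), skew x₁ (ca.dorf x₀ x₃), skew x₁ (ca.dorf x₂ x₃),
    skew x₂ (ca.dorf x₀ x₃), skew x₂ (ca.dorf x₁ x₃)]
  simp only [map_neg]
  linear_combination t - t' + t'' - s

end IsIsotropicProjector

end NaiveCocycle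

end CourantAlgebroid

/-! ### Hoist projectors, coherent forms and models of quadratic Lie algebroids -/

namespace QuadLieAlgebroid

section Projector

variable {A : Type} [CommRing A] [Algebra ℝ A]
variable {L : Type} [AddCommGroup L] [Module A L] [Module ℝ L] [IsScalarTower ℝ A L]
variable (Q : QuadLieAlgebroid A L)

/-- `h = κ ∘ a` for a hoist `κ`. -/
structure IsHoistProjector (h : L →ₗ[A] L) : Prop where
  anchor_apply : ∀ X, Q.anchor (h X) = Q.anchor X
  apply_of_anchor : ∀ r, Q.anchor r = 0 → h r = 0

/-- Coherence of a skew-symmetric 3-form with respect to a hoist projector. -/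
structure IsCoherentForm (h : L →ₗ[A] L) (C : L → L → L → A) : Prop where
  smul_add : ∀ (f : A) X X' Y Z, C (f • X + X') Y Z = f * C X Y Z + C X' Y Z
  swap_left : ∀ X Y Z, C X Y Z = -C Y X Z
  swap_right : ∀ X Y Z, C X Y Z = -C X Z Y
  ker : ∀ r s t, Q.anchor r = 0 → Q.anchor s = 0 → Q.anchor t = 0 →
    C r s t = -Q.ipG (Q.bracket r s) t
  ker_ker_hoist : ∀ r s X, Q.anchor r = 0 → Q.anchor s = 0 → C r s (h X) = 0
  ker_hoist_hoist : ∀ r X Y, Q.anchor r = 0 →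
    C r (h X) (h Y) = Q.ipG r (Q.bracket (h X) (h Y) - h (Q.bracket X Y))

variable {Q}

namespace IsHoistProjector

variable {h : L →ₗ[A] L}

lemma anchor_sub (hh : Q.IsHoistProjector h) (X : L) : Q.anchor (X - h X) = 0 := by
  rw [map_sub, hh.anchor_apply, sub_self]

lemma apply_apply (hh : Q.IsHoistProjector h) (X : L) : h (h X) = h X := by
  have := hh.apply_of_anchor _ (hh.anchor_sub X)
  rw [map_sub, sub_eq_zero] at this
  exact this.symm

end IsHoistProjector

namespace IsCoherentForm

variable {h : L →ₗ[A] L} {C : L → L → L → A}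

lemma add₁ (hC : Q.IsCoherentForm h C) (X X' Y Z : L) :
    C (X + X') Y Z = C X Y Z + C X' Y Z := by
  simpa using hC.smul_add 1 X X' Y Z

lemma add₂ (hC : Q.IsCoherentForm h C) (X Y Y' Z : L) :
    C X (Y + Y') Z = C X Y Z + C X Y' Z := by
  rw [hC.swap_left, hC.add₁, hC.swap_left Y, hC.swap_left Y']
  ring

lemma add₃ (hC : Q.IsCoherentForm h C) (X Y Z Z' : L) :
    C X Y (Z + Z') = C X Y Z + C X Y Z' := by
  rw [hC.swap_right, hC.add₂, hC.swap_right _ Z, hC.swap_right _ Z']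
  ring

end IsCoherentForm

end Projector

end QuadLieAlgebroid

namespace CourantAlgebroid

section Model

variable {A : Type} [CommRing A] [Algebra ℝ A]
variable {E : Type} [AddCommGroup E] [Module A E] [Module ℝ E] [IsScalarTower ℝ A E]
variable {L : Type} [AddCommGroup L] [Module A L] [Module ℝ L] [IsScalarTower ℝ A L]

/-- An identification of `Q` with the ample Lie algebroid of `ca`, together with a splitting
`s` of the projection `q` which is isotropic over the hoist projector `h`. -/
structure Model (ca : CourantAlgebroid A E) (Q : QuadLieAlgebroid A L) (h : L →ₗ[A] L) where
  /-- the projection -/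
  q : E →ₗ[A] L
  /-- the splitting -/
  s : L →ₗ[A] E
  hoist : Q.IsHoistProjector h
  q_s : ∀ X, q (s X) = X
  anchor_q : ∀ e, Q.anchor (q e) = ca.rho e
  q_eq_zero : ∀ e, q e = 0 ↔ e ∈ ca.perp
  q_dorf : ∀ e e', q (ca.dorf e e') = Q.bracket (q e) (q e')
  ip_ker : ∀ r r', ca.rho r = 0 → ca.rho r' = 0 → ca.ip r r' = Q.ipG (q r) (q r')
  ip_s_hoist : ∀ X Y, ca.ip (s (h X)) (s Y) = 0

namespace Model

variable {ca : CourantAlgebroid A E} {Q : QuadLieAlgebroid A L} {h : L →ₗ[A] L}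
variable (m : Model ca Q h)

lemma rho_s (X : L) : ca.rho (m.s X) = Q.anchor X := by
  rw [← m.anchor_q, m.q_s]

/-- The isotropic projector of a model. -/
def proj : E →ₗ[A] E := m.s ∘ₗ h ∘ₗ m.q

lemma proj_apply (e : E) : m.proj e = m.s (h (m.q e)) := rfl

lemma q_proj (e : E) : m.q (m.proj e) = h (m.q e) := m.q_s _

lemma isIsotropicProjector : ca.IsIsotropicProjector m.proj where
  rho_apply e := by rw [proj_apply, m.rho_s, m.hoist.anchor_apply, m.anchor_q]
  apply_of_rho e he := by
    rw [proj_apply, m.hoist.apply_of_anchor _ (by rw [m.anchor_q, he]), map_zero]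
  isotropic e e' := m.ip_s_hoist _ _

lemma form_eq_projForm {C : L → L → L → A} (hC : Q.IsCoherentForm h C)
    (H : ∀ X Y Z, C (h X) (h Y) (h Z) = 2 * ca.tri (m.s (h X)) (m.s (h Y)) (m.s (h Z)))
    (e₀ e₁ e₂ : E) :
    C (m.q e₀) (m.q e₁) (m.q e₂) = ca.projForm m.proj e₀ e₁ e₂ := by
  have hP := m.isIsotropicProjector
  have dec : ∀ e, m.q e = m.q (e - m.proj e) + h (m.q e) := fun e => by
    rw [map_sub, m.q_proj, sub_add_cancel]
  have anc : ∀ e, Q.anchor (m.q (e - m.proj e)) = 0 := fun e => by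
    rw [m.anchor_q, hP.rho_sub]
  have kkk : ∀ a b c, C (m.q (a - m.proj a)) (m.q (b - m.proj b)) (m.q (c - m.proj c))
      = -ca.tri (a - m.proj a) (b - m.proj b) (c - m.proj c) := fun a b c => by
    rw [hC.ker _ _ _ (anc a) (anc b) (anc c), ← m.q_dorf, tri, m.ip_ker _ _ _ (hP.rho_sub c)]
    rw [ca.rho_dorf, hP.rho_sub, zero_lie]
  have khh : ∀ a b c, C (m.q (a - m.proj a)) (h (m.q b)) (h (m.q c))
      = ca.tri (m.proj b) (m.proj c) (a - m.proj a)
        - ca.ip (m.proj (ca.dorf b c)) (a - m.proj a) := fun a b c => by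
    rw [hC.ker_hoist_hoist _ _ _ (anc a), ← m.q_dorf, ← m.q_proj b, ← m.q_proj c, ← m.q_dorf,
      ← m.q_proj, ← map_sub, ← m.ip_ker _ _ (hP.rho_sub a), ca.ip_symm, tri,
      ← LinearMap.sub_apply, ← map_sub]
    rw [map_sub, hP.rho_apply, ca.rho_dorf, ca.rho_dorf, hP.rho_apply, hP.rho_apply, sub_self]
  have kkh : ∀ a b c, C (m.q (a - m.proj a)) (m.q (b - m.proj b)) (h c) = 0 := fun a b c =>
    hC.ker_ker_hoist _ _ _ (anc a) (anc b)
  rw [dec e₀, dec e₁, dec e₂]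
  simp only [hC.add₁, hC.add₂, hC.add₃]
  rw [hC.swap_right (m.q (e₀ - m.proj e₀)) (h (m.q e₁)) (m.q (e₂ - m.proj e₂)),
    hC.swap_left (h (m.q e₀)) (m.q (e₁ - m.proj e₁)) (m.q (e₂ - m.proj e₂)),
    hC.swap_right (m.q (e₁ - m.proj e₁)) (h (m.q e₀)) (m.q (e₂ - m.proj e₂)),
    hC.swap_left (h (m.q e₀)) (m.q (e₁ - m.proj e₁)) (h (m.q e₂)),
    hC.swap_right (m.q (e₁ - m.proj e₁)) (h (m.q e₀)) (h (m.q e₂)),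
    hC.swap_right (h (m.q e₀)) (h (m.q e₁)) (m.q (e₂ - m.proj e₂)),
    hC.swap_left (h (m.q e₀)) (m.q (e₂ - m.proj e₂)) (h (m.q e₁))]
  simp only [kkk, khh, kkh, H]
  simp only [projForm, m.proj_apply]
  ring

lemma s_q_sub_mem_perp (e : E) : e - m.s (m.q e) ∈ ca.perp := by
  rw [← m.q_eq_zero, map_sub, m.q_s, sub_self]

lemma ip_eq (e e' : E) :
    ca.ip e e' = ca.ip e (m.s (m.q e')) + ca.ip e' (m.s (m.q e))
      - ca.ip (m.s (m.q e')) (m.s (m.q e)) := by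
  have h₁ := m.s_q_sub_mem_perp e' _ (ca.rho_of_mem_perp (m.s_q_sub_mem_perp e))
  simp only [map_sub, LinearMap.sub_apply] at h₁
  rw [ca.ip_symm e e', ca.ip_symm e (m.s (m.q e'))]
  linear_combination h₁

lemma ext {e e' : E} (hq : m.q e = m.q e')
    (hs : ∀ X, ca.ip e (m.s X) = ca.ip e' (m.s X)) : e = e' := by
  refine ca.ip_ext fun u => ?_
  rw [m.ip_eq e u, m.ip_eq e' u, hq, hs]

lemma ip_s_s (X Y : L) : ca.ip (m.s X) (m.s Y) = Q.ipG (X - h X) (Y - h Y) := by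
  have e₁ : m.s X = m.s (X - h X) + m.s (h X) := by rw [← map_add, sub_add_cancel]
  have e₂ : m.s Y = m.s (Y - h Y) + m.s (h Y) := by rw [← map_add, sub_add_cancel]
  rw [e₁, map_add, LinearMap.add_apply, m.ip_s_hoist, add_zero, e₂, map_add,
    ca.ip_symm _ (m.s (h Y)), m.ip_s_hoist, add_zero, m.ip_ker, m.q_s, m.q_s]
  · rw [m.rho_s, m.hoist.anchor_sub]
  · rw [m.rho_s, m.hoist.anchor_sub]

section Transfer

variable {E' : Type} [AddCommGroup E'] [Module A E'] [Module ℝ E'] [IsScalarTower ℝ A E']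
variable {ca' : CourantAlgebroid A E'}

lemma exists_transfer (m : Model ca Q h) (m' : Model ca' Q h) :
    ∃ Θ : E →ₗ[A] E', (∀ e, m'.q (Θ e) = m.q e) ∧
      ∀ e X, ca'.ip (Θ e) (m'.s X) = ca.ip e (m.s X) := by
  refine ⟨m'.s ∘ₗ m.q + ca'.sharp.toLinearMap ∘ₗ
    ((LinearMap.lcomp A A (m.s ∘ₗ m'.q)) ∘ₗ ca.ip ∘ₗ (LinearMap.id - m.s ∘ₗ m.q)),
    fun e => ?_, fun e X => ?_⟩
  · have : m'.q (ca'.sharp (LinearMap.lcomp A A (m.s ∘ₗ m'.q)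
        (ca.ip (e - m.s (m.q e))))) = 0 := by
      rw [m'.q_eq_zero]
      intro k hk
      rw [ip_sharp]
      exact m.s_q_sub_mem_perp e _ (by
        rw [LinearMap.mem_ker, LinearMap.comp_apply, m.rho_s, m'.anchor_q]; exact hk)
    simpa [m'.q_s] using this
  · simp only [LinearMap.add_apply, LinearMap.comp_apply, LinearEquiv.coe_coe, map_add, ip_sharp,
      LinearMap.lcomp_apply, LinearMap.sub_apply, LinearMap.id_apply, m'.q_s, map_sub, m'.ip_s_s,
      m.ip_s_s]
    ring

/-- Courant algebroids modelled on the same quadratic Lie algebroid with equal 3-forms `ℋ` are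
isomorphic. -/
lemma caIsomorphic (m : Model ca Q h) (m' : Model ca' Q h)
    (H : ∀ X Y Z, ca.tri (m.s (h X)) (m.s (h Y)) (m.s (h Z))
      = ca'.tri (m'.s (h X)) (m'.s (h Y)) (m'.s (h Z))) : CAIsomorphic ca ca' := by
  obtain ⟨Θ, hq, hs⟩ := m.exists_transfer m'
  obtain ⟨Θ', hq', hs'⟩ := m'.exists_transfer m
  have rho : ∀ e, ca'.rho (Θ e) = ca.rho e := fun e => by
    rw [← m'.anchor_q, hq, m.anchor_q]
  have sΘ : ∀ X, Θ (m.s X) = m'.s X := fun X =>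
    m'.ext (by rw [hq, m.q_s, m'.q_s]) fun Y => by rw [hs, m.ip_s_s, m'.ip_s_s]
  have ip : ∀ e e', ca'.ip (Θ e) (Θ e') = ca.ip e e' := fun e e' => by
    rw [m'.ip_eq, m.ip_eq, hq, hq, hs, hs, m.ip_s_s, m'.ip_s_s]
  have key : ∀ a b c, ca.tri a b c = ca'.tri (Θ a) (Θ b) (Θ c) := by
    have swap_left : ∀ a b c, ca.tri a b c - ca'.tri (Θ a) (Θ b) (Θ c)
        = -(ca.tri b a c - ca'.tri (Θ b) (Θ a) (Θ c)) := fun a b c => by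
      have h₁ := ca.tri_symm a b c
      have h₂ := ca'.tri_symm (Θ a) (Θ b) (Θ c)
      rw [rho, ip] at h₂
      linear_combination h₁ - h₂
    have swap_right : ∀ a b c, ca.tri a b c - ca'.tri (Θ a) (Θ b) (Θ c)
        = -(ca.tri a c b - ca'.tri (Θ a) (Θ c) (Θ b)) := fun a b c => by
      have h₁ := ca.tri_inv a b c
      have h₂ := ca'.tri_inv (Θ a) (Θ b) (Θ c)
      rw [rho, ip] at h₂
      linear_combination h₁ - h₂
    have right : ∀ a b c, ca.tri a b c - ca'.tri (Θ a) (Θ b) (Θ c)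
        = ca.tri a b (m.proj c) - ca'.tri (Θ a) (Θ b) (Θ (m.proj c)) := fun a b c => by
      have hz : Θ (ca.dorf a b) - ca'.dorf (Θ a) (Θ b) ∈ ca'.perp := by
        rw [← m'.q_eq_zero, map_sub, hq, m.q_dorf, m'.q_dorf, hq, hq, sub_self]
      have h₁ := hz (Θ (c - m.proj c)) (by
        rw [LinearMap.mem_ker, rho, m.isIsotropicProjector.rho_sub])
      simp only [map_sub, LinearMap.sub_apply, ip] at h₁
      simp only [tri]
      linear_combination h₁
    intro a b c
    have hP : ∀ e, Θ (m.proj e) = m'.s (h (m.q e)) := fun e => sΘ _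
    rw [← sub_eq_zero, right, swap_right, right, swap_left, swap_right, right, hP, hP, hP]
    simp only [m.proj_apply, H, sub_self, neg_zero]
  refine ⟨LinearEquiv.ofLinearMap Θ Θ' ?_ ?_, rho, ip, fun p p' => ?_⟩
  · ext e
    exact m'.ext (by simp [hq, hq']) fun X => by simp [hs, hs']
  · ext e
    exact m.ext (by simp [hq, hq']) fun X => by simp [hs, hs']
  · refine m'.ext ?_ fun X => ?_
    · simp only [LinearEquiv.coe_ofLinearMap, hq, m.q_dorf, m'.q_dorf]
    · rw [← sΘ]
      simp only [LinearEquiv.coe_ofLinearMap, ip]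
      exact key _ _ _

end Transfer

end Model

end Model

end CourantAlgebroid

/-! ### The model of a standard Courant algebroid -/

namespace QuadLieAlgebroid

section Standard

variable {A : Type} [CommRing A] [Algebra ℝ A]
variable {L : Type} [AddCommGroup L] [Module A L] [Module ℝ L] [IsScalarTower ℝ A L]
variable {Q : QuadLieAlgebroid A L}

/-- The projector `κ ∘ a` of a hoist `κ`. -/
def Hoist.projector (κ : Q.Hoist) : L →ₗ[A] L := κ.toFun ∘ₗ Q.anchor.rangeRestrict

lemma Hoist.projector_apply (κ : Q.Hoist) (X : L) :
    κ.projector X = κ.toFun (Q.anchor.rangeRestrict X) := rfl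

lemma Hoist.rangeRestrict_apply (κ : Q.Hoist) (x : ↥Q.Fq) :
    Q.anchor.rangeRestrict (κ.toFun x) = x := Subtype.ext (κ.sect x)

lemma Hoist.projector_hoist (κ : Q.Hoist) (x : ↥Q.Fq) : κ.projector (κ.toFun x) = κ.toFun x := by
  rw [κ.projector_apply, κ.rangeRestrict_apply]

lemma Hoist.isHoistProjector (κ : Q.Hoist) : Q.IsHoistProjector κ.projector where
  anchor_apply X := κ.sect _
  apply_of_anchor r hr := by
    have : Q.anchor.rangeRestrict r = 0 := Subtype.ext hr
    rw [κ.projector_apply, this, map_zero]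

lemma _root_.IsKCoherent.isCoherentForm {C : L → L → L → A} {κ : Q.Hoist}
    (hC : IsKCoherent Q C κ) : Q.IsCoherentForm κ.projector C where
  smul_add := hC.1
  swap_left := hC.2.1
  swap_right := hC.2.2.1
  ker := hC.2.2.2.2.1
  ker_ker_hoist r s X hr hs := hC.2.2.2.2.2.1 r s hr hs _
  ker_hoist_hoist r X Y hr := by
    rw [κ.projector_apply, κ.projector_apply, hC.2.2.2.2.2.2 r hr, Hoist.curv,
      κ.projector_apply]
    congr 4
    exact Subtype.ext (Q.anchor_bracket X Y).symm

/-- The projection `F* ⊕ 𝒢 ⊕ F → 𝒜` induced by a hoist. -/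
def Hoist.stdProj (κ : Q.Hoist) : (Module.Dual A ↥Q.Fq × ↥Q.Kq × ↥Q.Fq) →ₗ[A] L :=
  (Q.Kq.subtype.coprod κ.toFun) ∘ₗ LinearMap.snd A _ _

lemma Hoist.stdProj_apply (κ : Q.Hoist) (p : Module.Dual A ↥Q.Fq × ↥Q.Kq × ↥Q.Fq) :
    κ.stdProj p = (p.2.1 : L) + κ.toFun p.2.2 := rfl

/-- The splitting `𝒜 → F* ⊕ 𝒢 ⊕ F` induced by a hoist. -/
def Hoist.stdSection (κ : Q.Hoist) : L →ₗ[A] (Module.Dual A ↥Q.Fq × ↥Q.Kq × ↥Q.Fq) :=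
  LinearMap.prod 0 (LinearMap.prod
    ((LinearMap.id - κ.projector).codRestrict Q.Kq fun X => κ.isHoistProjector.anchor_sub X)
    Q.anchor.rangeRestrict)

lemma Hoist.stdSection_apply (κ : Q.Hoist) (X : L) :
    κ.stdSection X = (0, ⟨X - κ.projector X, κ.isHoistProjector.anchor_sub X⟩,
      Q.anchor.rangeRestrict X) := rfl

lemma Hoist.stdSection_projector (κ : Q.Hoist) (X : L) :
    κ.stdSection (κ.projector X) = (0, 0, Q.anchor.rangeRestrict X) := by
  rw [κ.stdSection_apply]
  refine Prod.ext rfl (Prod.ext (Subtype.ext ?_) (Subtype.ext ?_))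
  · simp [κ.isHoistProjector.apply_apply]
  · exact κ.isHoistProjector.anchor_apply X

lemma Hoist.anchor_stdProj (κ : Q.Hoist) (p : Module.Dual A ↥Q.Fq × ↥Q.Kq × ↥Q.Fq) :
    Q.anchor (κ.stdProj p) = p.2.2 := by
  rw [κ.stdProj_apply, map_add, κ.sect, LinearMap.mem_ker.1 p.2.1.2, zero_add]

variable {C : L → L → L → A} {κ : Q.Hoist}
  {ca : CourantAlgebroid A (Module.Dual A ↥Q.Fq × ↥Q.Kq × ↥Q.Fq)}

lemma _root_.RealizesES.anchor_stdProj (hR : RealizesES Q C κ ca)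
    (p : Module.Dual A ↥Q.Fq × ↥Q.Kq × ↥Q.Fq) : Q.anchor (κ.stdProj p) = ca.rho p := by
  rw [κ.anchor_stdProj, hR.1.1]

lemma _root_.RealizesES.stdProj_eq_zero (hR : RealizesES Q C κ ca)
    (p : Module.Dual A ↥Q.Fq × ↥Q.Kq × ↥Q.Fq) : κ.stdProj p = 0 ↔ p ∈ ca.perp := by
  rw [ca.mem_perp]
  constructor
  · intro h k hk
    have hx : p.2.2 = 0 := Subtype.ext (by rw [← κ.anchor_stdProj, h, map_zero]; rfl)
    have hr : p.2.1 = 0 := Subtype.ext (by rw [κ.stdProj_apply, hx] at h; simpa using h)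
    have hk' : k.2.2 = 0 := Subtype.ext (by rw [← hR.1.1, hk]; rfl)
    rw [hR.1.2.1, hx, hr, hk']
    simp
  · intro h
    have hx : p.2.2 = 0 := Subtype.ext (by rw [← hR.1.1, ca.rho_of_mem_perp h]; rfl)
    have hr : (p.2.1 : L) = 0 := Q.ipG_nondeg _ p.2.1.2 fun s hs => by
      have := h (0, ⟨s, hs⟩, 0) (by rw [hR.1.1]; rfl)
      rw [hR.1.2.1] at this
      simpa using this
    rw [κ.stdProj_apply, hx, hr, map_zero, zero_add]

lemma _root_.RealizesES.stdProj_dorf (hR : RealizesES Q C κ ca)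
    (p p' : Module.Dual A ↥Q.Fq × ↥Q.Kq × ↥Q.Fq) :
    κ.stdProj (ca.dorf p p') = Q.bracket (κ.stdProj p) (κ.stdProj p') := by
  have dual : ∀ ξ : Module.Dual A ↥Q.Fq,
      ((ξ, 0, 0) : Module.Dual A ↥Q.Fq × ↥Q.Kq × ↥Q.Fq) ∈ ca.perp := fun ξ => by
    rw [← hR.stdProj_eq_zero, κ.stdProj_apply]
    simp
  have fibre : ∀ x : ↥Q.Fq, κ.stdProj (0, 0, x) = κ.toFun x := fun x => by
    simp [κ.stdProj_apply]
  have vert : ∀ r : ↥Q.Kq, κ.stdProj (0, r, 0) = r := fun r => by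
    simp [κ.stdProj_apply]
  have last : ∀ a b, ((ca.dorf a b).2.2 : Derivation ℝ A A)
      = ⁅(a.2.2 : Derivation ℝ A A), (b.2.2 : Derivation ℝ A A)⁆ := fun a b => by
    rw [← hR.1.1, ca.rho_dorf, hR.1.1, hR.1.1]
  have hxy : ∀ x y : ↥Q.Fq, κ.stdProj (ca.dorf (0, 0, x) (0, 0, y))
      = Q.bracket (κ.toFun x) (κ.toFun y) := fun x y => by
    have h₁ : (ca.dorf (0, 0, x) (0, 0, y)).2.1 = κ.curvK x y := hR.2.2.1 x y
    have h₂ : (ca.dorf (0, 0, x) (0, 0, y)).2.2 = Q.fbk x y := Subtype.ext (last _ _)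
    rw [κ.stdProj_apply, h₁, h₂]
    exact sub_add_cancel _ _
  have hxr : ∀ (x : ↥Q.Fq) (r : ↥Q.Kq), κ.stdProj (ca.dorf (0, 0, x) (0, r, 0))
      = Q.bracket (κ.toFun x) r := fun x r => by
    have h₁ : (ca.dorf (0, 0, x) (0, r, 0)).2.1 = κ.nabla x r := hR.2.1 x r
    have h₂ : (ca.dorf (0, 0, x) (0, r, 0)).2.2 = 0 :=
      Subtype.ext ((last _ _).trans (lie_zero _))
    rw [κ.stdProj_apply, h₁, h₂, map_zero, add_zero]
    rfl
  have hrx : ∀ (x : ↥Q.Fq) (r : ↥Q.Kq), κ.stdProj (ca.dorf (0, r, 0) (0, 0, x))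
      = Q.bracket r (κ.toFun x) := fun x r => by
    have := (hR.stdProj_eq_zero _).2 (ca.dorf_add_swap_mem_perp (0, r, 0) (0, 0, x))
    rw [map_add, hxr] at this
    rw [Q.bracket_skew]
    exact eq_neg_of_add_eq_zero_left this
  have hrs : ∀ r s : ↥Q.Kq, κ.stdProj (ca.dorf (0, r, 0) (0, s, 0))
      = Q.bracket r s := fun r s => by
    have h₁ : (ca.dorf (0, r, 0) (0, s, 0)).2.1 = lGk r s := hR.1.2.2 r s
    have h₂ : (ca.dorf (0, r, 0) (0, s, 0)).2.2 = 0 :=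
      Subtype.ext ((last _ _).trans (lie_zero _))
    rw [κ.stdProj_apply, h₁, h₂, map_zero, add_zero]
    rfl
  have split : ∀ a : Module.Dual A ↥Q.Fq × ↥Q.Kq × ↥Q.Fq,
      a = (a.1, 0, 0) + ((0, a.2.1, 0) + (0, 0, a.2.2)) := fun a =>
    Prod.ext (by simp) (Prod.ext (by simp) (by simp))
  have zero_left : ∀ ξ a, κ.stdProj (ca.dorf (ξ, 0, 0) a) = 0 := fun ξ a =>
    (hR.stdProj_eq_zero _).2 (ca.dorf_left_mem_perp _ (dual ξ))
  have zero_right : ∀ ξ a, κ.stdProj (ca.dorf a (ξ, 0, 0)) = 0 := fun ξ a =>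
    (hR.stdProj_eq_zero _).2 (ca.dorf_right_mem_perp _ (dual ξ))
  obtain ⟨ξ, r, x⟩ := p
  obtain ⟨η, s, y⟩ := p'
  rw [split (ξ, r, x), split (η, s, y)]
  simp only [map_add, LinearMap.add_apply, zero_left, zero_right, hxy, hxr, hrx, hrs, fibre, vert,
    (hR.stdProj_eq_zero _).2 (dual _), zero_add]

/-- A realization of `E^s(𝒜; C, κ)` is modelled on `𝒜`. -/
def _root_.RealizesES.model (hR : RealizesES Q C κ ca) :
    CourantAlgebroid.Model ca Q κ.projector where
  q := κ.stdProj
  s := κ.stdSection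
  hoist := κ.isHoistProjector
  q_s X := by
    rw [κ.stdProj_apply, κ.stdSection_apply]
    exact sub_add_cancel _ _
  anchor_q := hR.anchor_stdProj
  q_eq_zero := hR.stdProj_eq_zero
  q_dorf := hR.stdProj_dorf
  ip_ker r r' hr hr' := by
    have hx : r.2.2 = 0 := Subtype.ext (by rw [← hR.1.1, hr]; rfl)
    have hx' : r'.2.2 = 0 := Subtype.ext (by rw [← hR.1.1, hr']; rfl)
    rw [hR.1.2.1, κ.stdProj_apply, κ.stdProj_apply, hx, hx']
    simp
  ip_s_hoist X Y := by
    rw [κ.stdSection_projector, κ.stdSection_apply, hR.1.2.1]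
    simp

lemma _root_.RealizesES.form_hoist (hR : RealizesES Q C κ ca) (X Y Z : L) :
    C (κ.projector X) (κ.projector Y) (κ.projector Z) =
      2 * ca.tri (hR.model.s (κ.projector X)) (hR.model.s (κ.projector Y))
        (hR.model.s (κ.projector Z)) := by
  have h : ∀ X, hR.model.s (κ.projector X) = (0, 0, Q.anchor.rangeRestrict X) :=
    κ.stdSection_projector
  rw [h, h, h, CourantAlgebroid.tri, hR.1.2.1]
  simp only [LinearMap.zero_apply, smul_zero, add_zero, ZeroMemClass.coe_zero, map_zero,
    two_mul_half_smul]
  exact (hR.2.2.2 _ _ _).symm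

end Standard

end QuadLieAlgebroid

/-! ### Functoriality of models -/

namespace QuadLieAlgebroid

section Iso

variable {A : Type} [CommRing A] [Algebra ℝ A]
variable {L₁ : Type} [AddCommGroup L₁] [Module A L₁] [Module ℝ L₁] [IsScalarTower ℝ A L₁]
variable {L₂ : Type} [AddCommGroup L₂] [Module A L₂] [Module ℝ L₂] [IsScalarTower ℝ A L₂]

/-- `σ` is an isomorphism of quadratic Lie algebroids. -/
structure IsIso (Q₁ : QuadLieAlgebroid A L₁) (Q₂ : QuadLieAlgebroid A L₂) (σ : L₁ ≃ₗ[A] L₂) :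
    Prop where
  anchor_apply : ∀ X, Q₂.anchor (σ X) = Q₁.anchor X
  map_bracket : ∀ X Y, σ (Q₁.bracket X Y) = Q₂.bracket (σ X) (σ Y)
  ipG_apply : ∀ r s, Q₁.anchor r = 0 → Q₁.anchor s = 0 → Q₂.ipG (σ r) (σ s) = Q₁.ipG r s

namespace IsIso

variable {Q₁ : QuadLieAlgebroid A L₁} {Q₂ : QuadLieAlgebroid A L₂} {σ : L₁ ≃ₗ[A] L₂}

lemma symm (hσ : IsIso Q₁ Q₂ σ) : IsIso Q₂ Q₁ σ.symm where
  anchor_apply X := by rw [← hσ.anchor_apply, σ.apply_symm_apply]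
  map_bracket X Y := by
    rw [σ.symm_apply_eq, hσ.map_bracket, σ.apply_symm_apply, σ.apply_symm_apply]
  ipG_apply r s hr hs := by
    rw [← hσ.ipG_apply, σ.apply_symm_apply, σ.apply_symm_apply]
    · rw [← hσ.anchor_apply, σ.apply_symm_apply, hr]
    · rw [← hσ.anchor_apply, σ.apply_symm_apply, hs]

lemma isHoistProjector (hσ : IsIso Q₁ Q₂ σ) {h : L₁ →ₗ[A] L₁} (hh : Q₁.IsHoistProjector h) :
    Q₂.IsHoistProjector (σ.conj h) where
  anchor_apply X := by
    rw [LinearEquiv.conj_apply_apply, hσ.anchor_apply, hh.anchor_apply, hσ.symm.anchor_apply]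
  apply_of_anchor r hr := by
    rw [LinearEquiv.conj_apply_apply, hh.apply_of_anchor _ (by rw [hσ.symm.anchor_apply, hr]),
      map_zero]

lemma isCoherentForm (hσ : IsIso Q₁ Q₂ σ) {h : L₁ →ₗ[A] L₁} {C : L₁ → L₁ → L₁ → A}
    (hh : Q₁.IsHoistProjector h) (hC : Q₁.IsCoherentForm h C) :
    Q₂.IsCoherentForm (σ.conj h) (fun X Y Z => C (σ.symm X) (σ.symm Y) (σ.symm Z)) where
  smul_add f X X' Y Z := by rw [map_add, map_smul, hC.smul_add]
  swap_left X Y Z := hC.swap_left _ _ _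
  swap_right X Y Z := hC.swap_right _ _ _
  ker r s t hr hs ht := by
    rw [← hσ.symm.anchor_apply] at hr hs ht
    rw [hC.ker _ _ _ hr hs ht, ← hσ.symm.map_bracket, hσ.symm.ipG_apply _ t]
    · rw [← hσ.symm.anchor_apply, hσ.symm.map_bracket, Q₁.anchor_bracket, hr, zero_lie]
    · rwa [hσ.symm.anchor_apply] at ht
  ker_ker_hoist r s X hr hs := by
    rw [← hσ.symm.anchor_apply] at hr hs
    rw [LinearEquiv.conj_apply_apply, σ.symm_apply_apply, hC.ker_ker_hoist _ _ _ hr hs]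
  ker_hoist_hoist r X Y hr := by
    have hr' := hr
    rw [← hσ.symm.anchor_apply] at hr
    simp only [LinearEquiv.conj_apply_apply, σ.symm_apply_apply]
    rw [hC.ker_hoist_hoist _ _ _ hr, hσ.symm.map_bracket, ← hσ.map_bracket, ← map_sub,
      ← hσ.ipG_apply _ _ hr, σ.apply_symm_apply]
    rw [map_sub, Q₁.anchor_bracket, hh.anchor_apply, hh.anchor_apply, hh.anchor_apply,
      Q₁.anchor_bracket, sub_self]

end IsIso

end Iso

end QuadLieAlgebroid

namespace CourantAlgebroid

section Functoriality

variable {A : Type} [CommRing A] [Algebra ℝ A]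
variable {E : Type} [AddCommGroup E] [Module A E] [Module ℝ E] [IsScalarTower ℝ A E]
variable {E' : Type} [AddCommGroup E'] [Module A E'] [Module ℝ E'] [IsScalarTower ℝ A E']
variable {L₁ : Type} [AddCommGroup L₁] [Module A L₁] [Module ℝ L₁] [IsScalarTower ℝ A L₁]
variable {L₂ : Type} [AddCommGroup L₂] [Module A L₂] [Module ℝ L₂] [IsScalarTower ℝ A L₂]
variable {ca : CourantAlgebroid A E} {ca' : CourantAlgebroid A E'}
variable {Q₁ : QuadLieAlgebroid A L₁} {h₁ : L₁ →ₗ[A] L₁}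
variable {Q₂ : QuadLieAlgebroid A L₂} {h₂ : L₂ →ₗ[A] L₂}

/-- Pullback of a model along an isomorphism of Courant algebroids. -/
def Model.pullback (m : Model ca' Q₁ h₁) (Θ : E ≃ₗ[A] E')
    (hrho : ∀ p, ca'.rho (Θ p) = ca.rho p) (hip : ∀ p q, ca'.ip (Θ p) (Θ q) = ca.ip p q)
    (hdorf : ∀ p q, Θ (ca.dorf p q) = ca'.dorf (Θ p) (Θ q)) : Model ca Q₁ h₁ where
  q := m.q ∘ₗ Θ
  s := Θ.symm.toLinearMap ∘ₗ m.s
  hoist := m.hoist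
  q_s X := by simp [m.q_s]
  anchor_q e := by simp [m.anchor_q, hrho]
  q_eq_zero e := by
    rw [LinearMap.comp_apply, m.q_eq_zero]
    simp only [mem_perp]
    constructor
    · intro H k hk
      rw [← hip]
      exact H _ (by rw [hrho, hk])
    · intro H k hk
      rw [← Θ.apply_symm_apply k] at hk ⊢
      rw [hrho] at hk
      exact (hip _ _).trans (H _ hk)
  q_dorf e e' := by simp [m.q_dorf, hdorf]
  ip_ker r r' hr hr' := by
    rw [← hip, m.ip_ker _ _ (by rw [hrho, hr]) (by rw [hrho, hr'])]
    rfl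
  ip_s_hoist X Y := by
    rw [← hip]
    simpa using m.ip_s_hoist X Y

/-- Transport of a model along an isomorphism of quadratic Lie algebroids. -/
def Model.transport (m : Model ca Q₁ h₁) {σ : L₁ ≃ₗ[A] L₂}
    (hσ : QuadLieAlgebroid.IsIso Q₁ Q₂ σ) : Model ca Q₂ (σ.conj h₁) where
  q := σ.toLinearMap ∘ₗ m.q
  s := m.s ∘ₗ σ.symm.toLinearMap
  hoist := hσ.isHoistProjector m.hoist
  q_s X := by simp [m.q_s]
  anchor_q e := by simp [hσ.anchor_apply, m.anchor_q]
  q_eq_zero e := by simp [m.q_eq_zero]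
  q_dorf e e' := by simp [m.q_dorf, hσ.map_bracket]
  ip_ker r r' hr hr' := by
    rw [m.ip_ker _ _ hr hr']
    exact (hσ.ipG_apply _ _ (by rw [m.anchor_q, hr]) (by rw [m.anchor_q, hr'])).symm
  ip_s_hoist X Y := by simp [m.ip_s_hoist]

namespace IsIsotropicProjector

variable {P P' : E →ₗ[A] E}

lemma skewForm_sub_of_mem_perp (hP : ca.IsIsotropicProjector P)
    (hP' : ca.IsIsotropicProjector P') {z : E} (hz : z ∈ ca.perp) (e : E) :
    ca.skewForm (P - P') z e = 0 := by
  have h₁ : ca.ip ((P - P') e) z = 0 := by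
    rw [ca.ip_symm]
    exact hz _ (by rw [LinearMap.mem_ker, LinearMap.sub_apply, map_sub, hP.rho_apply,
      hP'.rho_apply, sub_self])
  rw [skewForm, h₁, LinearMap.sub_apply, hP.apply_of_rho _ (ca.rho_of_mem_perp hz),
    hP'.apply_of_rho _ (ca.rho_of_mem_perp hz)]
  simp

end IsIsotropicProjector

lemma skewForm_swap (J : E →ₗ[A] E) (e e' : E) : ca.skewForm J e e' = -ca.skewForm J e' e := by
  simp [skewForm]

lemma skewForm_smul_add (J : E →ₗ[A] E) (f : A) (a a' e : E) :
    ca.skewForm J (f • a + a') e = f * ca.skewForm J a e + ca.skewForm J a' e := by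
  simp [skewForm]
  ring

/-- Two models of the same Courant algebroid have equivalent characteristic pairs. -/
lemma Model.pairsEquiv (m₁ : Model ca Q₁ h₁) (m₂ : Model ca Q₂ h₂)
    {C₁ : L₁ → L₁ → L₁ → A} {C₂ : L₂ → L₂ → L₂ → A}
    (hC₁ : ∀ a b c, C₁ (m₁.q a) (m₁.q b) (m₁.q c) = ca.projForm m₁.proj a b c)
    (hC₂ : ∀ a b c, C₂ (m₂.q a) (m₂.q b) (m₂.q c) = ca.projForm m₂.proj a b c) :
    PairsEquiv Q₁ C₁ Q₂ C₂ := by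
  have q₂s₁ : ∀ e, m₂.q (m₁.s (m₁.q e)) = m₂.q e := fun e => by
    have := (m₂.q_eq_zero _).2 (m₁.s_q_sub_mem_perp e)
    rw [map_sub, sub_eq_zero] at this
    exact this.symm
  have q₁s₂ : ∀ e, m₁.q (m₂.s (m₂.q e)) = m₁.q e := fun e => by
    have := (m₁.q_eq_zero _).2 (m₂.s_q_sub_mem_perp e)
    rw [map_sub, sub_eq_zero] at this
    exact this.symm
  have hP₁ := m₁.isIsotropicProjector
  have hP₂ := m₂.isIsotropicProjector
  refine ⟨LinearEquiv.ofLinearMap (m₂.q ∘ₗ m₁.s) (m₁.q ∘ₗ m₂.s) ?_ ?_, fun X => ?_, fun X Y => ?_,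
    fun r s hr hs => ?_, fun X Y => ca.skewForm (m₁.proj - m₂.proj) (m₁.s X) (m₁.s Y),
    fun f X X' Y => ?_, fun X Y => ca.skewForm_swap _ _ _, fun r s hr hs => ?_, fun X Y Z => ?_⟩
  · ext X
    simp [q₂s₁, m₂.q_s]
  · ext X
    simp [q₁s₂, m₁.q_s]
  · simp [m₂.anchor_q, m₁.rho_s]
  · have h : m₁.q (ca.dorf (m₁.s X) (m₁.s Y)) = Q₁.bracket X Y := by
      rw [m₁.q_dorf, m₁.q_s, m₁.q_s]
    simp only [LinearEquiv.coe_ofLinearMap, LinearMap.comp_apply]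
    rw [← h, q₂s₁, m₂.q_dorf]
  · have hr' : ca.rho (m₁.s r) = 0 := by rw [m₁.rho_s]; exact hr
    have hs' : ca.rho (m₁.s s) = 0 := by rw [m₁.rho_s]; exact hs
    simp only [LinearEquiv.coe_ofLinearMap, LinearMap.comp_apply]
    rw [← m₂.ip_ker _ _ hr' hs', m₁.ip_ker _ _ hr' hs', m₁.q_s, m₁.q_s]
  · simp only [map_add, map_smul, skewForm_smul_add]
  · have hr' : ca.rho (m₁.s r) = 0 := by rw [m₁.rho_s]; exact hr
    have hs' : ca.rho (m₁.s s) = 0 := by rw [m₁.rho_s]; exact hs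
    simp only [skewForm, LinearMap.sub_apply, hP₁.apply_of_rho _ hr', hP₁.apply_of_rho _ hs',
      hP₂.apply_of_rho _ hr', hP₂.apply_of_rho _ hs']
    simp
  · have hbr : ∀ X Y Z, ca.skewForm (m₁.proj - m₂.proj) (ca.dorf (m₁.s X) (m₁.s Y)) (m₁.s Z)
        = ca.skewForm (m₁.proj - m₂.proj) (m₁.s (Q₁.bracket X Y)) (m₁.s Z) := fun X Y Z => by
      have hz : ca.dorf (m₁.s X) (m₁.s Y) - m₁.s (Q₁.bracket X Y) ∈ ca.perp := by
        rw [← m₁.q_eq_zero, map_sub, m₁.q_dorf, m₁.q_s, m₁.q_s, m₁.q_s, sub_self]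
      have := hP₁.skewForm_sub_of_mem_perp hP₂ hz (m₁.s Z)
      simp only [skewForm, map_sub, LinearMap.sub_apply] at this ⊢
      linear_combination this
    have h := hP₂.projForm_sub_projForm hP₁ (m₁.s X) (m₁.s Y) (m₁.s Z)
    rw [← hC₁, ← hC₂] at h
    simp only [dCE2, hbr, m₁.rho_s, m₁.q_s] at h
    exact h

end Functoriality

end CourantAlgebroid

/-! ### Normalisation of an equivalence of characteristic pairs -/

namespace QuadLieAlgebroid

section Central

variable {A : Type} [CommRing A] [Algebra ℝ A]
variable {L : Type} [AddCommGroup L] [Module A L] [Module ℝ L] [IsScalarTower ℝ A L]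
variable (Q : QuadLieAlgebroid A L)

/-- A 1-cocycle with values in the centre of `𝒢`. -/
structure IsCentralCocycle (β : L →ₗ[A] L) : Prop where
  anchor_apply : ∀ X, Q.anchor (β X) = 0
  apply_of_anchor : ∀ r, Q.anchor r = 0 → β r = 0
  central : ∀ X r, Q.anchor r = 0 → Q.bracket (β X) r = 0
  closed : ∀ X Y, β (Q.bracket X Y) = Q.bracket X (β Y) - Q.bracket Y (β X)

variable {Q}

lemma eq_zero_of_ipG {r : L} (hr : Q.anchor r = 0)
    (h : ∀ s, Q.anchor s = 0 → Q.ipG r s = 0) : r = 0 :=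
  Q.ipG_nondeg r hr h

lemma anchor_bracket_eq_zero (X : L) {r : L} (hr : Q.anchor r = 0) :
    Q.anchor (Q.bracket X r) = 0 := Q.bracket_mem_ker X hr

lemma anchor_bracket_left_eq_zero {r : L} (X : L) (hr : Q.anchor r = 0) :
    Q.anchor (Q.bracket r X) = 0 := by
  rw [Q.anchor_bracket, hr, zero_lie]

lemma ipG_bracket_of_ker {r s t : L} (hr : Q.anchor r = 0) (hs : Q.anchor s = 0)
    (ht : Q.anchor t = 0) : Q.ipG (Q.bracket r s) t = Q.ipG r (Q.bracket s t) := by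
  have h := Q.ipG_inv s r t hr ht
  rw [hs, Q.bracket_skew s r, map_neg, LinearMap.neg_apply, Derivation.zero_apply] at h
  linear_combination h

namespace IsCentralCocycle

variable {β : L →ₗ[A] L}

lemma apply_apply (hβ : Q.IsCentralCocycle β) (X : L) : β (β X) = 0 :=
  hβ.apply_of_anchor _ (hβ.anchor_apply X)

lemma ipG_bracket (hβ : Q.IsCentralCocycle β) (X : L) {r s : L} (hr : Q.anchor r = 0)
    (hs : Q.anchor s = 0) : Q.ipG (β X) (Q.bracket r s) = 0 := by
  rw [← ipG_bracket_of_ker (hβ.anchor_apply X) hr hs, hβ.central X r hr, map_zero,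
    LinearMap.zero_apply]

lemma apply_hoist (hβ : Q.IsCentralCocycle β) {h : L →ₗ[A] L} (hh : Q.IsHoistProjector h) (X : L) :
    β (h X) = β X := by
  have := hβ.apply_of_anchor _ (hh.anchor_sub X)
  rw [map_sub, sub_eq_zero] at this
  exact this.symm

/-- The automorphism `1 - β`. -/
def equiv (hβ : Q.IsCentralCocycle β) : L ≃ₗ[A] L :=
  LinearEquiv.ofLinearMap (LinearMap.id - β) (LinearMap.id + β)
    (LinearMap.ext fun X => by simp [hβ.apply_apply])
    (LinearMap.ext fun X => by simp [hβ.apply_apply])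

lemma equiv_apply (hβ : Q.IsCentralCocycle β) (X : L) : hβ.equiv X = X - β X := rfl

lemma equiv_symm_apply (hβ : Q.IsCentralCocycle β) (X : L) : hβ.equiv.symm X = X + β X := rfl

lemma isIso (hβ : Q.IsCentralCocycle β) : IsIso Q Q hβ.equiv where
  anchor_apply X := by rw [hβ.equiv_apply, map_sub, hβ.anchor_apply, sub_zero]
  map_bracket X Y := by
    simp only [hβ.equiv_apply, hβ.closed, map_sub, LinearMap.sub_apply,
      hβ.central X _ (hβ.anchor_apply Y), Q.bracket_skew (β X) Y]
    abel
  ipG_apply r s hr hs := by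
    rw [hβ.equiv_apply, hβ.equiv_apply, hβ.apply_of_anchor r hr, hβ.apply_of_anchor s hs,
      sub_zero, sub_zero]

lemma conj_apply (hβ : Q.IsCentralCocycle β) {h : L →ₗ[A] L} (hh : Q.IsHoistProjector h) (X : L) :
    hβ.equiv.conj h X = h X - β X := by
  rw [LinearEquiv.conj_apply_apply, hβ.equiv_symm_apply, hβ.equiv_apply, map_add,
    hh.apply_of_anchor _ (hβ.anchor_apply X), add_zero, hβ.apply_hoist hh]

/-- The 2-form relating a coherent 3-form to its pullback along `1 + β`. -/
def twoForm (Q : QuadLieAlgebroid A L) (β h : L →ₗ[A] L) : L →ₗ[A] L →ₗ[A] A :=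
  Q.ipG.compl₁₂ β (LinearMap.id - h) - (Q.ipG.compl₁₂ β (LinearMap.id - h)).flip

lemma twoForm_apply (β h : L →ₗ[A] L) (X Y : L) :
    twoForm Q β h X Y = Q.ipG (β X) (Y - h Y) - Q.ipG (β Y) (X - h X) := rfl

lemma form_add_apply (hβ : Q.IsCentralCocycle β) {h : L →ₗ[A] L} (hh : Q.IsHoistProjector h)
    {C : L → L → L → A} (hC : Q.IsCoherentForm h C) (X Y Z : L) :
    C (X + β X) (Y + β Y) (Z + β Z) - C X Y Z
      = dCE2 (fun X f => Q.anchor X f) (fun X Y => Q.bracket X Y)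
        (fun X Y => twoForm Q β h X Y) X Y Z := by
  have one : ∀ X Y Z, C (β X) Y Z
      = Q.ipG (β X) (Q.bracket (h Y) (h Z) - h (Q.bracket Y Z)) := fun X Y Z => by
    have dec : ∀ X, X = (X - h X) + h X := fun X => (sub_add_cancel X (h X)).symm
    conv_lhs => rw [dec Y, dec Z]
    rw [hC.add₂, hC.add₃, hC.add₃,
      hC.ker _ _ _ (hβ.anchor_apply X) (hh.anchor_sub Y) (hh.anchor_sub Z),
      hβ.central X _ (hh.anchor_sub Y),
      hC.ker_ker_hoist _ _ _ (hβ.anchor_apply X) (hh.anchor_sub Y),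
      hC.swap_right _ (h Y) (Z - h Z),
      hC.ker_ker_hoist _ _ _ (hβ.anchor_apply X) (hh.anchor_sub Z),
      hC.ker_hoist_hoist _ _ _ (hβ.anchor_apply X)]
    simp
  have two : ∀ X Y Z, C (β X) (β Y) Z = 0 := fun X Y Z => by
    rw [one, hh.apply_of_anchor _ (hβ.anchor_apply Y),
      hh.apply_of_anchor _ (anchor_bracket_left_eq_zero Z (hβ.anchor_apply Y))]
    simp
  have inv : ∀ X Y Z, Q.anchor X (Q.ipG (β Y) (Z - h Z))
      = Q.ipG (Q.bracket X (β Y)) (Z - h Z) + Q.ipG (β Y) (Q.bracket X (Z - h Z)) := fun X Y Z =>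
    Q.ipG_inv _ _ _ (hβ.anchor_apply Y) (hh.anchor_sub Z)
  have curv : ∀ X Y Z, Q.ipG (β X) (Q.bracket (h Y) (h Z) - h (Q.bracket Y Z))
      = Q.ipG (β X) (Q.bracket Y Z - h (Q.bracket Y Z)) - Q.ipG (β X) (Q.bracket Y (Z - h Z))
        + Q.ipG (β X) (Q.bracket Z (Y - h Y)) := fun X Y Z => by
    have h₁ := hβ.ipG_bracket X (hh.anchor_sub Y) (hh.anchor_sub Z)
    have h₂ := Q.bracket_skew Z Y
    have h₃ := Q.bracket_skew Z (h Y)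
    simp only [map_sub, LinearMap.sub_apply, h₂, h₃, map_neg] at h₁ ⊢
    linear_combination h₁
  rw [hC.add₁, hC.add₂, hC.add₂, hC.add₃, hC.add₃, hC.add₃, hC.add₃, two,
    hC.swap_left X (β Y), hC.swap_left X (β Y), hC.swap_right (β Y) X (β Z), two, two,
    hC.swap_right X Y (β Z), hC.swap_left X (β Z), hC.swap_right (β X) Y (β Z), two, one, one, one,
    curv, curv, curv]
  have anchor_sub : ∀ X f g, Q.anchor X (f - g) = Q.anchor X f - Q.anchor X g := fun X =>
    map_sub (Q.anchor X)
  simp only [dCE2, twoForm_apply, anchor_sub, inv]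
  simp only [hβ.closed, map_sub, LinearMap.sub_apply,
    Q.bracket_skew Z, Q.bracket_skew Y X, map_neg, LinearMap.neg_apply]
  ring

end IsCentralCocycle

end Central

end QuadLieAlgebroid

/-! ### Equivalent pairs give isomorphic Courant algebroids -/

namespace QuadLieAlgebroid

section Comparison

variable {A : Type} [CommRing A] [Algebra ℝ A]
variable {L : Type} [AddCommGroup L] [Module A L] [Module ℝ L] [IsScalarTower ℝ A L]
variable {Q : QuadLieAlgebroid A L}

lemma IsCentralCocycle.half {β : L →ₗ[A] L} (hβ : Q.IsCentralCocycle β) :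
    Q.IsCentralCocycle ((2 : ℝ)⁻¹ • β) where
  anchor_apply X := by
    rw [LinearMap.smul_apply, LinearMap.map_smul_of_tower, hβ.anchor_apply, smul_zero]
  apply_of_anchor r hr := by rw [LinearMap.smul_apply, hβ.apply_of_anchor r hr, smul_zero]
  central X r hr := by
    rw [LinearMap.smul_apply, map_smul, LinearMap.smul_apply, hβ.central X r hr, smul_zero]
  closed X Y := by
    simp only [LinearMap.smul_apply, map_smul, hβ.closed, smul_sub]

variable {h₁ h₂ : L →ₗ[A] L} {C₁ C₂ : L → L → L → A}

/-- If two coherent 3-forms differ by `dφ`, then the difference between the mixed part of `φ` and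
the difference of the hoists is a central cocycle. -/
lemma IsCoherentForm.isCentralCocycle (hC₁ : Q.IsCoherentForm h₁ C₁)
    (hC₂ : Q.IsCoherentForm h₂ C₂) (hh₁ : Q.IsHoistProjector h₁) (hh₂ : Q.IsHoistProjector h₂)
    {φ : L →ₗ[A] L →ₗ[A] A} (hφ : ∀ X Y, φ X Y = -φ Y X)
    (hφK : ∀ r s, Q.anchor r = 0 → Q.anchor s = 0 → φ r s = 0)
    (hd : ∀ X Y Z, C₁ X Y Z - C₂ X Y Z
      = dCE2 (fun X f => Q.anchor X f) (fun X Y => Q.bracket X Y) (fun X Y => φ X Y) X Y Z)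
    {J : L →ₗ[A] L} (hJK : ∀ X, Q.anchor (J X) = 0) (hJ : ∀ r, Q.anchor r = 0 → J r = 0)
    (hφJ : ∀ r X, Q.anchor r = 0 → φ r (h₁ X) = -Q.ipG (J X) r) :
    Q.IsCentralCocycle (J - (h₁ - h₂)) := by
  have hK : ∀ X, Q.anchor ((h₁ - h₂) X) = 0 := fun X => by
    rw [LinearMap.sub_apply, map_sub, hh₁.anchor_apply, hh₂.anchor_apply, sub_self]
  have hβK : ∀ X, Q.anchor ((J - (h₁ - h₂)) X) = 0 := fun X => by
    rw [LinearMap.sub_apply, map_sub, hJK, hK, sub_zero]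
  have dec : ∀ X, h₁ X = h₂ X + (h₁ - h₂) X := fun X => by simp
  have hbr : ∀ r X, Q.anchor r = 0 → Q.anchor (Q.bracket r X) = 0 := fun r X hr =>
    anchor_bracket_left_eq_zero X hr
  have central : ∀ X r, Q.anchor r = 0 → Q.bracket ((J - (h₁ - h₂)) X) r = 0 := fun X r hr => by
    refine eq_zero_of_ipG (hbr _ _ (hβK X)) fun s hs => ?_
    rw [ipG_bracket_of_ker (hβK X) hr hs]
    have h := hd r s (h₁ X)
    rw [hC₁.ker_ker_hoist _ _ _ hr hs, dec X, hC₂.add₃, hC₂.ker_ker_hoist _ _ _ hr hs,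
      hC₂.ker _ _ _ hr hs (hK X), ← dec X] at h
    simp only [dCE2] at h
    rw [hφK r s hr hs, hφK _ s (hbr _ _ hr) hs, hφK _ r (hbr _ _ hs) hr, hφJ _ _ (hbr _ _ hr), hr,
      hs, Q.ipG_symm _ ((h₁ - h₂) X), map_zero] at h
    simp only [Derivation.zero_apply] at h
    rw [LinearMap.sub_apply, map_sub, LinearMap.sub_apply]
    linear_combination -h
  refine ⟨hβK, fun r hr => ?_, central, fun X Y => ?_⟩
  · rw [LinearMap.sub_apply, LinearMap.sub_apply, hJ r hr, hh₁.apply_of_anchor r hr,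
      hh₂.apply_of_anchor r hr]
    simp
  · have swap : ∀ X Y, Q.bracket X ((J - (h₁ - h₂)) Y)
        = Q.bracket (h₁ X) ((J - (h₁ - h₂)) Y) := fun X Y => by
      have := central Y (X - h₁ X) (hh₁.anchor_sub X)
      rw [Q.bracket_skew, neg_eq_zero, map_sub, LinearMap.sub_apply, sub_eq_zero] at this
      exact this
    rw [swap X Y, swap Y X, ← sub_eq_zero]
    refine eq_zero_of_ipG (Q := Q) ?_ fun r hr => ?_
    · rw [map_sub, map_sub, hβK, anchor_bracket_eq_zero _ (hβK Y),
        anchor_bracket_eq_zero _ (hβK X), sub_zero, sub_zero]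
    have h := hd r (h₁ X) (h₁ Y)
    have e₁ := hC₁.ker_hoist_hoist r X Y hr
    have e₂ : C₂ r (h₁ X) (h₁ Y) = Q.ipG r (Q.bracket (h₂ X) (h₂ Y) - h₂ (Q.bracket X Y))
        - Q.ipG r (Q.bracket ((h₁ - h₂) X) ((h₁ - h₂) Y)) := by
      rw [dec X, dec Y, hC₂.add₂, hC₂.add₃, hC₂.add₃, hC₂.ker_hoist_hoist _ _ _ hr,
        hC₂.swap_right r (h₂ X), hC₂.ker_ker_hoist _ _ _ hr (hK Y),
        hC₂.ker_ker_hoist _ _ _ hr (hK X), hC₂.ker _ _ _ hr (hK X) (hK Y),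
        ipG_bracket_of_ker hr (hK X) (hK Y)]
      ring
    have e₃ : ∀ X Y, Q.anchor (h₁ X) (φ r (h₁ Y))
        = -Q.ipG (Q.bracket (h₁ X) (J Y)) r + φ (Q.bracket (h₁ X) r) (h₁ Y) := fun X Y => by
      rw [hφJ _ _ hr, hφJ _ _ (anchor_bracket_eq_zero _ hr), map_neg,
        Q.ipG_inv _ _ _ (hJK Y) hr]
      ring
    have e₄ : φ (Q.bracket (h₁ X) (h₁ Y)) r = Q.ipG (J (Q.bracket X Y)) r := by
      have hn : Q.anchor (Q.bracket (h₁ X) (h₁ Y) - h₁ (Q.bracket X Y)) = 0 := by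
        rw [map_sub, hh₁.anchor_apply, Q.anchor_bracket, Q.anchor_bracket, hh₁.anchor_apply,
          hh₁.anchor_apply, sub_self]
      have := hφK _ r hn hr
      rw [map_sub, LinearMap.sub_apply, hφ (h₁ _), hφJ _ _ hr] at this
      linear_combination this
    simp only [dCE2] at h
    rw [e₁, e₂, e₃, e₃, e₄, hr, Q.bracket_skew r (h₁ X), Q.bracket_skew r (h₁ Y)] at h
    simp only [Derivation.zero_apply, map_neg, LinearMap.neg_apply, map_sub, LinearMap.sub_apply,
      Q.ipG_symm r] at h
    have s₁ := Q.bracket_skew (h₁ Y) (h₁ X)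
    have s₂ := Q.bracket_skew (h₁ Y) (h₂ X)
    simp only [map_sub, LinearMap.sub_apply, s₁, s₂, map_neg, LinearMap.neg_apply]
    linear_combination h

end Comparison

end QuadLieAlgebroid

namespace CourantAlgebroid

section Straighten

variable {A : Type} [CommRing A] [Algebra ℝ A]
variable {E : Type} [AddCommGroup E] [Module A E] [Module ℝ E] [IsScalarTower ℝ A E]
variable (ca : CourantAlgebroid A E)

/-- The projection of `E` onto `P(E) ⊕ P(E)ᗮ ∩ ker ρ` along `(ker ρ)ᗮ`. -/
noncomputable def straighten (P : E →ₗ[A] E) : E →ₗ[A] E :=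
  LinearMap.id - ca.sharp.toLinearMap ∘ₗ LinearMap.lcomp A A P ∘ₗ ca.ip ∘ₗ (LinearMap.id - P)

variable {ca}

lemma ip_straighten (P : E →ₗ[A] E) (e u : E) :
    ca.ip (ca.straighten P e) u = ca.ip e u - ca.ip (e - P e) (P u) := by
  simp [straighten]

namespace IsIsotropicProjector

variable {P : E →ₗ[A] E}

lemma straighten_of_mem_perp (hP : ca.IsIsotropicProjector P) {z : E} (hz : z ∈ ca.perp) :
    ca.straighten P z = 0 := by
  refine ca.ip_ext fun u => ?_
  have h := hz _ (hP.rho_sub u)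
  rw [map_sub, sub_eq_zero] at h
  rw [ip_straighten, hP.apply_of_rho z (ca.rho_of_mem_perp hz), sub_zero, h, sub_self]
  simp

lemma straighten_apply_apply (hP : ca.IsIsotropicProjector P) (e : E) :
    ca.straighten P (P e) = P e := by
  refine ca.ip_ext fun u => ?_
  rw [ip_straighten, hP.apply_apply]
  simp

lemma sub_straighten_mem_perp (hP : ca.IsIsotropicProjector P) (e : E) :
    e - ca.straighten P e ∈ ca.perp := fun k hk => by
  rw [map_sub, LinearMap.sub_apply, ip_straighten, hP.apply_of_rho k hk]
  simp

lemma ip_apply_straighten (hP : ca.IsIsotropicProjector P) (e e' : E) :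
    ca.ip (P e) (ca.straighten P e') = 0 := by
  rw [ca.ip_symm, ip_straighten, hP.apply_apply, map_sub, LinearMap.sub_apply, hP.isotropic]
  simp

end IsIsotropicProjector

variable {L : Type} [AddCommGroup L] [Module A L] [Module ℝ L] [IsScalarTower ℝ A L]
variable {Q : QuadLieAlgebroid A L} {h h' : L →ₗ[A] L}

/-- Change of splitting of a model. -/
noncomputable def Model.changeProj (m : Model ca Q h) {P : E →ₗ[A] E}
    (hP : ca.IsIsotropicProjector P) (hh' : Q.IsHoistProjector h')
    (hq : ∀ e, m.q (P e) = h' (m.q e)) : Model ca Q h' where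
  q := m.q
  s := ca.straighten P ∘ₗ m.s
  hoist := hh'
  q_s X := by
    have := (m.q_eq_zero _).2 (hP.sub_straighten_mem_perp (m.s X))
    rw [map_sub, sub_eq_zero, m.q_s] at this
    exact this.symm
  anchor_q := m.anchor_q
  q_eq_zero := m.q_eq_zero
  q_dorf := m.q_dorf
  ip_ker := m.ip_ker
  ip_s_hoist X Y := by
    have h₁ : ca.straighten P (m.s (h' X)) = P (m.s X) := by
      have := hP.straighten_of_mem_perp (m.s_q_sub_mem_perp (P (m.s X)))
      rw [map_sub, sub_eq_zero, hP.straighten_apply_apply, hq, m.q_s] at this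
      exact this.symm
    rw [LinearMap.comp_apply, h₁]
    exact hP.ip_apply_straighten _ _

lemma Model.changeProj_s_hoist (m : Model ca Q h) {P : E →ₗ[A] E}
    (hP : ca.IsIsotropicProjector P) (hh' : Q.IsHoistProjector h')
    (hq : ∀ e, m.q (P e) = h' (m.q e)) (e : E) :
    (m.changeProj hP hh' hq).s (h' (m.q e)) = P e := by
  have := hP.straighten_of_mem_perp (m.s_q_sub_mem_perp (P e))
  rw [map_sub, sub_eq_zero, hP.straighten_apply_apply, hq] at this
  exact this.symm

end Straighten

end CourantAlgebroid

namespace CourantAlgebroid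

section Equivalence

variable {A : Type} [CommRing A] [Algebra ℝ A]
variable {E : Type} [AddCommGroup E] [Module A E] [Module ℝ E] [IsScalarTower ℝ A E]
variable {E' : Type} [AddCommGroup E'] [Module A E'] [Module ℝ E'] [IsScalarTower ℝ A E']
variable {L : Type} [AddCommGroup L] [Module A L] [Module ℝ L] [IsScalarTower ℝ A L]
variable {ca : CourantAlgebroid A E} {ca' : CourantAlgebroid A E'}
variable {Q : QuadLieAlgebroid A L} {h h' : L →ₗ[A] L}

lemma Model.exists_mixed (m : Model ca Q h) (φ : L →ₗ[A] L →ₗ[A] A)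
    (hφ : ∀ X Y, φ X Y = -φ Y X) :
    ∃ J : L →ₗ[A] L, (∀ X, Q.anchor (J X) = 0) ∧ (∀ r, Q.anchor r = 0 → J r = 0) ∧
      ∀ r X, Q.anchor r = 0 → φ r (h X) = -Q.ipG (J X) r := by
  have hJ : ∀ X, ca.rho (ca.sharp (LinearMap.lcomp A A (m.q - h ∘ₗ m.q) (φ (h X)))) = 0 :=
    fun X => ca.rho_eq_zero_of_ip_D fun f => by
      rw [ip_sharp, LinearMap.lcomp_apply, LinearMap.sub_apply, LinearMap.comp_apply,
        (m.q_eq_zero _).2 (ca.D_mem_perp f)]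
      simp
  refine ⟨m.q ∘ₗ ca.sharp.toLinearMap ∘ₗ LinearMap.lcomp A A (m.q - h ∘ₗ m.q) ∘ₗ φ ∘ₗ h,
    fun X => ?_, fun r hr => ?_, fun r X hr => ?_⟩
  · rw [← hJ X, ← m.anchor_q]
    rfl
  · simp [m.hoist.apply_of_anchor r hr]
  · have hr' : ca.rho (m.s r) = 0 := by rw [m.rho_s, hr]
    have := m.ip_ker _ _ (hJ X) hr'
    rw [ip_sharp, LinearMap.lcomp_apply, LinearMap.sub_apply, LinearMap.comp_apply, m.q_s,
      m.hoist.apply_of_anchor r hr, sub_zero] at this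
    rw [hφ, this]
    rfl

/-- A 2-form on `𝒜` with the right mixed part is induced by a change of splitting. -/
lemma Model.exists_isIsotropicProjector (m : Model ca Q h) (hh' : Q.IsHoistProjector h')
    {φ : L →ₗ[A] L →ₗ[A] A} (hφ : ∀ X Y, φ X Y = -φ Y X)
    (hφK : ∀ r s, Q.anchor r = 0 → Q.anchor s = 0 → φ r s = 0)
    (hmix : ∀ r X, Q.anchor r = 0 → φ r (h' X) = -Q.ipG (h' X - h X) r) :
    ∃ P, ca.IsIsotropicProjector P ∧ (∀ e, m.q (P e) = h' (m.q e)) ∧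
      ∀ e e', ca.skewForm (P - m.proj) e e' = φ (m.q e) (m.q e') := by
  have hP := m.isIsotropicProjector
  have hK : ∀ X, Q.anchor (h' X - h X) = 0 := fun X => by
    rw [map_sub, hh'.anchor_apply, m.hoist.anchor_apply, sub_self]
  -- the `(ker ρ)ᗮ`-component of the change of splitting
  let ψ : E →ₗ[A] E →ₗ[A] A := algebraMap ℝ A 2⁻¹ •
    (φ.compl₁₂ (h ∘ₗ m.q) (h ∘ₗ m.q) - Q.ipG.compl₁₂ ((h' - h) ∘ₗ m.q) ((h' - h) ∘ₗ m.q))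
  have hψ : ∀ e e', 2 * ψ e e' = φ (h (m.q e)) (h (m.q e'))
      - Q.ipG (h' (m.q e) - h (m.q e)) (h' (m.q e') - h (m.q e')) := fun e e' => by
    simp only [ψ, LinearMap.smul_apply, smul_eq_mul, ← mul_assoc, two_mul_algebraMap_half, one_mul]
    rfl
  have hψK : ∀ e e', ca.rho e' = 0 → ψ e e' = 0 := fun e e' he' => by
    apply two_mul_inj
    rw [← m.anchor_q] at he'
    rw [hψ, m.hoist.apply_of_anchor _ he', hh'.apply_of_anchor _ he']
    simp
  have hψK' : ∀ e, ca.rho e = 0 → ψ e = 0 := fun e he => LinearMap.ext fun e' => by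
    apply two_mul_inj
    rw [← m.anchor_q] at he
    rw [hψ, m.hoist.apply_of_anchor _ he, hh'.apply_of_anchor _ he]
    simp
  have hψperp : ∀ e, ca.sharp (ψ e) ∈ ca.perp := fun e k hk => by
    rw [ip_sharp]
    exact hψK _ _ hk
  let J : E →ₗ[A] E := m.s ∘ₗ (h' - h) ∘ₗ m.q + ca.sharp.toLinearMap ∘ₗ ψ
  have hJ : ∀ e, J e = m.s (h' (m.q e) - h (m.q e)) + ca.sharp (ψ e) := fun e => rfl
  have qJ : ∀ e, m.q (J e) = h' (m.q e) - h (m.q e) := fun e => by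
    rw [hJ, map_add, m.q_s, (m.q_eq_zero _).2 (hψperp e), add_zero]
  have rhoJ : ∀ e, ca.rho (J e) = 0 := fun e => by rw [← m.anchor_q, qJ, hK]
  have ipJK : ∀ e r, ca.rho r = 0 → ca.ip (J e) r = Q.ipG (h' (m.q e) - h (m.q e)) (m.q r) :=
    fun e r hr => by rw [m.ip_ker _ _ (rhoJ e) hr, qJ]
  have ipJP : ∀ e e', ca.ip (J e) (m.proj e') = ψ e e' := fun e e' => by
    have h₁ := hψK e _ (hP.rho_sub e')
    rw [map_sub, sub_eq_zero] at h₁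
    rw [hJ, map_add, LinearMap.add_apply, ip_sharp, ca.ip_symm, m.proj_apply, m.ip_s_hoist,
      zero_add, h₁]
    rfl
  have ipJJ : ∀ e e', ca.ip (J e) (J e')
      = Q.ipG (h' (m.q e) - h (m.q e)) (h' (m.q e') - h (m.q e')) := fun e e' => by
    rw [ipJK _ _ (rhoJ e'), qJ]
  refine ⟨m.proj + J, ⟨fun e => ?_, fun e he => ?_, fun e e' => ?_⟩, fun e => ?_, fun e e' => ?_⟩
  · rw [LinearMap.add_apply, map_add, rhoJ, hP.rho_apply, add_zero]
  · rw [LinearMap.add_apply, hP.apply_of_rho e he, hJ, hψK' e he]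
    rw [← m.anchor_q] at he
    rw [m.hoist.apply_of_anchor _ he, hh'.apply_of_anchor _ he]
    simp
  · apply two_mul_inj
    simp only [LinearMap.add_apply, map_add]
    rw [ipJJ, ipJP, ca.ip_symm (m.proj e) (J e'), ipJP, hP.isotropic]
    have h₁ := hψ e e'
    have h₂ := hψ e' e
    rw [hφ, Q.ipG_symm] at h₂
    linear_combination h₁ + h₂
  · rw [LinearMap.add_apply, map_add, m.q_proj, qJ, add_sub_cancel]
  · have dec : ∀ e e', ca.ip (J e) e' = ψ e e'
        + Q.ipG (h' (m.q e) - h (m.q e)) (m.q e' - h (m.q e')) := fun e e' => by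
      conv_lhs => rw [← add_sub_cancel (m.proj e') e']
      rw [map_add, ipJP, ipJK _ _ (hP.rho_sub e'), map_sub m.q, m.q_proj]
    have mixed : ∀ r X, Q.anchor r = 0 → φ r (h X) = -Q.ipG (h' X - h X) r := fun r X hr => by
      rw [← hmix r X hr, ← sub_eq_zero, ← map_sub]
      exact hφK _ _ hr (by rw [← neg_sub, map_neg, hK, neg_zero])
    have h₁ := hψ e e'
    have h₂ := hψ e' e
    have h₃ := hφK _ _ (m.hoist.anchor_sub (m.q e)) (m.hoist.anchor_sub (m.q e'))
    have h₄ := mixed _ (m.q e') (m.hoist.anchor_sub (m.q e))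
    have h₅ := mixed _ (m.q e) (m.hoist.anchor_sub (m.q e'))
    have h₆ := hφ (m.q e') (h (m.q e))
    have h₇ := hφ (h (m.q e')) (h (m.q e))
    have h₈ := Q.ipG_symm (h' (m.q e') - h (m.q e')) (h' (m.q e) - h (m.q e))
    rw [skewForm, add_sub_cancel_left, dec, dec]
    apply two_mul_inj
    rw [map_sub φ, LinearMap.sub_apply, map_sub (φ _), map_sub (φ _)] at h₃
    rw [map_sub φ, LinearMap.sub_apply] at h₄ h₅
    linear_combination h₁ - h₂ - 2 * h₃ - 2 * h₄ + 2 * h₅ - 2 * h₆ + h₇ + h₈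

lemma Model.caIsomorphic_of_twoForm (m : Model ca Q h) (m' : Model ca' Q h')
    {C C' : L → L → L → A}
    (hC : ∀ X Y Z, C (h X) (h Y) (h Z) = 2 * ca.tri (m.s (h X)) (m.s (h Y)) (m.s (h Z)))
    (hC' : ∀ a b c, C' (m'.q a) (m'.q b) (m'.q c) = ca'.projForm m'.proj a b c)
    {φ : L →ₗ[A] L →ₗ[A] A} (hφ : ∀ X Y, φ X Y = -φ Y X)
    (hφK : ∀ r s, Q.anchor r = 0 → Q.anchor s = 0 → φ r s = 0)
    (hmix : ∀ r X, Q.anchor r = 0 → φ r (h X) = -Q.ipG (h X - h' X) r)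
    (hd : ∀ X Y Z, C X Y Z - C' X Y Z
      = dCE2 (fun X f => Q.anchor X f) (fun X Y => Q.bracket X Y) (fun X Y => φ X Y) X Y Z) :
    CAIsomorphic ca ca' := by
  obtain ⟨P, hP, hqP, hskew⟩ := m'.exists_isIsotropicProjector m.hoist hφ hφK hmix
  refine m.caIsomorphic (m'.changeProj hP m.hoist hqP) fun X Y Z => ?_
  have form : ∀ a b c, ca'.projForm P a b c = C (m'.q a) (m'.q b) (m'.q c) := fun a b c => by
    have h₁ := m'.isIsotropicProjector.projForm_sub_projForm hP a b c
    have h₂ := hd (m'.q a) (m'.q b) (m'.q c)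
    rw [← hC'] at h₁
    simp only [dCE2, hskew, m'.anchor_q, m'.q_dorf] at h₁ h₂
    linear_combination h₁ - h₂
  have hs : ∀ X, (m'.changeProj hP m.hoist hqP).s (h X) = P (m'.s X) := fun X => by
    rw [← m'.changeProj_s_hoist hP m.hoist hqP, m'.q_s]
  have h₃ := form (P (m'.s X)) (P (m'.s Y)) (P (m'.s Z))
  rw [hqP, hqP, hqP, m'.q_s, m'.q_s, m'.q_s, hC, projForm, hP.apply_apply, hP.apply_apply,
    hP.apply_apply] at h₃
  rw [hs, hs, hs]
  apply two_mul_inj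
  rw [← h₃]
  simp [tri]

/-- Courant algebroids modelled on equivalent characteristic pairs are isomorphic. -/
lemma Model.caIsomorphic_of_pairsEquiv
    {L' : Type} [AddCommGroup L'] [Module A L'] [Module ℝ L'] [IsScalarTower ℝ A L']
    {Q' : QuadLieAlgebroid A L'} {k : L' →ₗ[A] L'}
    (m : Model ca Q h) (m' : Model ca' Q' k) {C : L → L → L → A} {C' : L' → L' → L' → A}
    (hC : Q.IsCoherentForm h C) (hC' : Q'.IsCoherentForm k C')
    (H : ∀ X Y Z, C (h X) (h Y) (h Z) = 2 * ca.tri (m.s (h X)) (m.s (h Y)) (m.s (h Z)))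
    (H' : ∀ X Y Z, C' (k X) (k Y) (k Z) = 2 * ca'.tri (m'.s (k X)) (m'.s (k Y)) (m'.s (k Z)))
    (e : PairsEquiv Q C Q' C') : CAIsomorphic ca ca' := by
  obtain ⟨σ, hσ₁, hσ₂, hσ₃, φ₀, hφ₀, hφs, hφK, hd⟩ := e
  have hσ : QuadLieAlgebroid.IsIso Q Q' σ := ⟨hσ₁, hσ₂, hσ₃⟩
  obtain ⟨φ, rfl⟩ : ∃ φ : L →ₗ[A] L →ₗ[A] A, φ₀ = fun X Y => φ X Y := by
    have hadd : ∀ X X' Y, φ₀ (X + X') Y = φ₀ X Y + φ₀ X' Y := fun X X' Y => by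
      simpa using hφ₀ 1 X X' Y
    have hsmul : ∀ (f : A) X Y, φ₀ (f • X) Y = f • φ₀ X Y := fun f X Y => by
      have h₀ := hadd 0 0 Y
      rw [add_zero, left_eq_add] at h₀
      simpa [h₀] using hφ₀ f X 0 Y
    refine ⟨LinearMap.mk₂ A φ₀ hadd hsmul (fun X Y Y' => ?_) (fun f X Y => ?_), rfl⟩
    · rw [hφs, hadd, hφs Y, hφs Y']
      ring
    · rw [hφs, hsmul, hφs X, smul_neg]
  -- move the second model to `Q`
  let m₂ := m'.transport hσ.symm
  have hC₂ := hσ.symm.isCoherentForm m'.hoist hC'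
  have form' : ∀ a b c, C' (σ (m₂.q a)) (σ (m₂.q b)) (σ (m₂.q c)) = ca'.projForm m₂.proj a b c :=
    fun a b c => m₂.form_eq_projForm hC₂ (fun X Y Z => by
      simpa [m₂, Model.transport] using H' (σ X) (σ Y) (σ Z)) a b c
  obtain ⟨J, hJK, hJ, hφJ⟩ := m.exists_mixed φ hφs
  have hβ := (hC.isCentralCocycle hC₂ m.hoist m₂.hoist hφs hφK hd hJK hJ hφJ).half
  set β := (2 : ℝ)⁻¹ • (J - (h - σ.symm.conj k)) with β_def
  have hββ : ∀ X, β X + β X = J X - (h X - σ.symm.conj k X) := fun X => by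
    rw [β_def, LinearMap.smul_apply, ← add_smul]
    norm_num
  refine m.caIsomorphic_of_twoForm (m₂.transport hβ.isIso)
    (C' := fun X Y Z => C' (σ (hβ.equiv.symm X)) (σ (hβ.equiv.symm Y)) (σ (hβ.equiv.symm Z)))
    (φ := φ - QuadLieAlgebroid.IsCentralCocycle.twoForm Q β (σ.symm.conj k)) H (fun a b c => ?_)
    (fun X Y => ?_)
    (fun r s hr hs => ?_) (fun r X hr => ?_) (fun X Y Z => ?_)
  · have hp : (m₂.transport hβ.isIso).proj = m₂.proj := by
      ext e
      simp [Model.proj, Model.transport]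
    rw [hp, ← form']
    simp [Model.transport]
  · simp only [LinearMap.sub_apply, QuadLieAlgebroid.IsCentralCocycle.twoForm_apply]
    have : φ X Y = -φ Y X := hφs X Y
    linear_combination this
  · simp [QuadLieAlgebroid.IsCentralCocycle.twoForm_apply, hφK r s hr hs, hβ.apply_of_anchor r hr,
      hβ.apply_of_anchor s hs]
  · have hr' := m₂.hoist.apply_of_anchor r hr
    have h₁ := congrArg (fun Y => Q.ipG Y r) (hββ X)
    simp only [map_sub, map_add, LinearMap.sub_apply, LinearMap.add_apply] at h₁
    rw [LinearMap.sub_apply, LinearMap.sub_apply, hφJ r X hr,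
      QuadLieAlgebroid.IsCentralCocycle.twoForm_apply, hβ.apply_of_anchor r hr, hr', hβ.apply_hoist m.hoist,
      hβ.conj_apply m₂.hoist]
    simp only [map_sub, LinearMap.sub_apply, map_zero, LinearMap.zero_apply]
    linear_combination h₁
  · have h₁ := hd X Y Z
    have h₂ := hβ.form_add_apply m₂.hoist hC₂ X Y Z
    simp only [dCE2, LinearMap.sub_apply, LinearEquiv.symm_symm, hβ.equiv_symm_apply] at h₁ h₂ ⊢
    have anchor_sub : ∀ X f g, Q.anchor X (f - g) = Q.anchor X f - Q.anchor X g := fun X =>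
      map_sub (Q.anchor X)
    simp only [anchor_sub]
    linear_combination h₁ - h₂

end Equivalence

end CourantAlgebroid

/-! ### Isomorphic Courant algebroids have equivalent pairs -/

namespace CourantAlgebroid

section Pullback

variable {A : Type} [CommRing A] [Algebra ℝ A]
variable {E : Type} [AddCommGroup E] [Module A E] [Module ℝ E] [IsScalarTower ℝ A E]
variable {E' : Type} [AddCommGroup E'] [Module A E'] [Module ℝ E'] [IsScalarTower ℝ A E']
variable {L : Type} [AddCommGroup L] [Module A L] [Module ℝ L] [IsScalarTower ℝ A L]
variable {ca : CourantAlgebroid A E} {ca' : CourantAlgebroid A E'}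
variable {Q : QuadLieAlgebroid A L} {h : L →ₗ[A] L}

lemma Model.form_eq_projForm_pullback (m : Model ca' Q h) {Θ : E ≃ₗ[A] E'}
    (hrho : ∀ p, ca'.rho (Θ p) = ca.rho p) (hip : ∀ p q, ca'.ip (Θ p) (Θ q) = ca.ip p q)
    (hdorf : ∀ p q, Θ (ca.dorf p q) = ca'.dorf (Θ p) (Θ q))
    {C : L → L → L → A} (hC : Q.IsCoherentForm h C)
    (H : ∀ X Y Z, C (h X) (h Y) (h Z) = 2 * ca'.tri (m.s (h X)) (m.s (h Y)) (m.s (h Z)))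
    (a b c : E) :
    C (m.q (Θ a)) (m.q (Θ b)) (m.q (Θ c))
      = ca.projForm (m.pullback Θ hrho hip hdorf).proj a b c := by
  refine (m.pullback Θ hrho hip hdorf).form_eq_projForm hC (fun X Y Z => ?_) a b c
  rw [H, tri, tri, ← hip, hdorf]
  simp [Model.pullback]

end Pullback

end CourantAlgebroid

/-! ### The naive 3-cocycle of a dissection -/

namespace Dissection

variable {A : Type} [CommRing A] [Algebra ℝ A]
variable {F : Submodule A (Derivation ℝ A A)}
variable {G : Type} [AddCommGroup G] [Module A G]
variable {E : Type} [AddCommGroup E] [Module A E] [Module ℝ E] [IsScalarTower ℝ A E]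
variable {lG : G → G → G} {ipG : G → G → A} {ca : CourantAlgebroid A E}

/-- The isotropic projector of a dissection. -/
def proj (d : Dissection F lG ipG ca) : E →ₗ[A] E :=
  d.toEquiv.toLinearMap ∘ₗ LinearMap.prodMap 0 (LinearMap.prodMap 0 LinearMap.id) ∘ₗ
    d.toEquiv.symm.toLinearMap

lemma proj_apply (d : Dissection F lG ipG ca) (e : E) :
    d.proj e = d.toEquiv (0, 0, (d.toEquiv.symm e).2.2) := rfl

lemma rho_apply (d : Dissection F lG ipG ca) (e : E) :
    ca.rho e = (d.toEquiv.symm e).2.2 := by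
  rw [← d.anchor, d.toEquiv.apply_symm_apply]

lemma ip_toEquiv (d : Dissection F lG ipG ca) (e : E) (p : Module.Dual A ↥F × G × ↥F) :
    ca.ip e (d.toEquiv p) = (2:ℝ)⁻¹ • (d.toEquiv.symm e).1 p.2.2
        + (2:ℝ)⁻¹ • p.1 (d.toEquiv.symm e).2.2 + ipG (d.toEquiv.symm e).2.1 p.2.1 := by
  rw [← d.metric, d.toEquiv.apply_symm_apply]

lemma ipG_zero_left (d : Dissection F lG ipG ca) (s : G) : ipG 0 s = 0 := by
  have := d.metric 0 (0, s, 0)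
  simpa using this.symm

lemma ipG_zero_right (d : Dissection F lG ipG ca) (s : G) : ipG s 0 = 0 := by
  have := d.metric (0, s, 0) 0
  simpa using this.symm

lemma isIsotropicProjector (d : Dissection F lG ipG ca) : ca.IsIsotropicProjector d.proj where
  rho_apply e := by rw [d.proj_apply, d.anchor, d.rho_apply]
  apply_of_rho e he := by
    have : (d.toEquiv.symm e).2.2 = 0 := Subtype.ext (by rw [← d.rho_apply, he]; rfl)
    rw [d.proj_apply, this]
    exact map_zero _
  isotropic e e' := by
    rw [d.proj_apply, d.proj_apply, d.metric]
    simp [d.ipG_zero_left]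

lemma sub_proj (d : Dissection F lG ipG ca) (e : E) : e - d.proj e =
    d.toEquiv ((d.toEquiv.symm e).1, (d.toEquiv.symm e).2.1, 0) := by
  rw [d.proj_apply, sub_eq_iff_eq_add, ← map_add, ← d.toEquiv.symm_apply_eq]
  simp

lemma dual_mem_perp (d : Dissection F lG ipG ca) (ξ : Module.Dual A ↥F) :
    d.toEquiv (ξ, 0, 0) ∈ ca.perp := fun k hk => by
  have hk' : (d.toEquiv.symm k).2.2 = 0 := Subtype.ext (by rw [← d.rho_apply, hk]; rfl)
  rw [ca.ip_symm, d.ip_toEquiv, hk', d.ipG_zero_right]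
  simp

lemma Cform_eq_projForm (d : Dissection F lG ipG ca) (e₀ e₁ e₂ : E) :
    d.Cform e₀ e₁ e₂ = ca.projForm d.proj e₀ e₁ e₂ := by
  have hP := d.isIsotropicProjector
  have curv : ∀ a b c, ca.tri (d.proj a) (d.proj b) (c - d.proj c)
      - ca.ip (d.proj (ca.dorf a b)) (c - d.proj c)
      = ipG (d.Rmap (d.toEquiv.symm a).2.2 (d.toEquiv.symm b).2.2) (d.toEquiv.symm c).2.1 :=
    fun a b c => by
    have h : (d.toEquiv.symm (ca.dorf (d.proj a) (d.proj b))).2.2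
        = (d.toEquiv.symm (d.proj (ca.dorf a b))).2.2 := Subtype.ext (by
      rw [← d.rho_apply, ← d.rho_apply, hP.rho_apply, ca.rho_dorf, ca.rho_dorf, hP.rho_apply,
        hP.rho_apply])
    have h' : (d.toEquiv.symm (d.proj (ca.dorf a b))).2.1 = 0 := by
      rw [d.proj_apply, d.toEquiv.symm_apply_apply]
    rw [CourantAlgebroid.tri, d.sub_proj, d.ip_toEquiv, d.ip_toEquiv, h, h', d.ipG_zero_left,
      Rmap]
    simp only [map_zero, smul_zero, zero_add, add_zero, add_sub_cancel_left]
    rfl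
  have vert : ca.tri (e₀ - d.proj e₀) (e₁ - d.proj e₁) (e₂ - d.proj e₂)
      = ipG (lG (d.toEquiv.symm e₀).2.1 (d.toEquiv.symm e₁).2.1) (d.toEquiv.symm e₂).2.1 := by
    have dec : ∀ e, e - d.proj e = d.toEquiv ((d.toEquiv.symm e).1, 0, 0)
        + d.toEquiv (0, (d.toEquiv.symm e).2.1, 0) := fun e => by
      rw [d.sub_proj, ← map_add]
      simp
    have last : (d.toEquiv.symm (ca.dorf (d.toEquiv (0, (d.toEquiv.symm e₀).2.1, 0))
        (d.toEquiv (0, (d.toEquiv.symm e₁).2.1, 0)))).2.2 = 0 := Subtype.ext (by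
      rw [← d.rho_apply, ca.rho_dorf, d.anchor, d.anchor]
      exact lie_zero _)
    have h₀ := ca.dorf_left_mem_perp (e₁ - d.proj e₁) (d.dual_mem_perp (d.toEquiv.symm e₀).1)
      _ (hP.rho_sub e₂)
    have h₁ := ca.dorf_right_mem_perp (d.toEquiv (0, (d.toEquiv.symm e₀).2.1, 0))
      (d.dual_mem_perp (d.toEquiv.symm e₁).1) _ (hP.rho_sub e₂)
    rw [CourantAlgebroid.tri, dec e₀, map_add, LinearMap.add_apply, map_add, LinearMap.add_apply,
      h₀, dec e₁, map_add (ca.dorf _), map_add, LinearMap.add_apply, h₁, d.sub_proj, d.ip_toEquiv,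
      last, d.gbracket]
    simp
  have hoist : 2 * ca.tri (d.proj e₀) (d.proj e₁) (d.proj e₂)
      = d.Hmap (d.toEquiv.symm e₀).2.2 (d.toEquiv.symm e₁).2.2 (d.toEquiv.symm e₂).2.2 := by
    rw [CourantAlgebroid.tri, d.proj_apply e₂, d.ip_toEquiv, d.ipG_zero_right]
    simp only [LinearMap.zero_apply, smul_zero, add_zero, two_mul_half_smul]
    rfl
  rw [CourantAlgebroid.projForm, curv, curv, curv, vert, hoist, Cform]

end Dissection

namespace CourantAlgebroid

section Naive

variable {A : Type} [CommRing A] [Algebra ℝ A]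
variable {E : Type} [AddCommGroup E] [Module A E] [Module ℝ E] [IsScalarTower ℝ A E]
variable {ca : CourantAlgebroid A E} {P P' : E →ₗ[A] E}

lemma courantBk_sub_dorf_mem_perp (ca : CourantAlgebroid A E) (a b : E) :
    courantBk ca a b - ca.dorf a b ∈ ca.perp := by
  have h : courantBk ca a b - ca.dorf a b = -ca.Dmap (ca.ip a b) := by
    have := ca.dorf_sym a b
    rw [courantBk, eq_sub_of_add_eq' this]
    module
  rw [h]
  exact ca.perp.neg_mem (ca.D_mem_perp _)

/-- The naive 3-forms of two isotropic projectors differ by a naive coboundary. -/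
lemma IsIsotropicProjector.projForm_sub_projForm_naive (hP : ca.IsIsotropicProjector P)
    (hP' : ca.IsIsotropicProjector P') (a b c : E) :
    ca.projForm P' a b c - ca.projForm P a b c = dCE2 (fun e f => ca.rho e f) (courantBk ca)
      (ca.skewForm (P' - P)) a b c := by
  have hbr : ∀ a b c, ca.skewForm (P' - P) (courantBk ca a b) c
      = ca.skewForm (P' - P) (ca.dorf a b) c := fun a b c => by
    have := hP'.skewForm_sub_of_mem_perp hP (ca.courantBk_sub_dorf_mem_perp a b) c
    simp only [skewForm, map_sub, LinearMap.sub_apply] at this ⊢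
    linear_combination this
  rw [hP.projForm_sub_projForm hP']
  simp only [dCE2, hbr]

end Naive

end CourantAlgebroid

/-! ### Realizing a modelled Courant algebroid in standard form -/

namespace CourantAlgebroid

section Realization

variable {A : Type} [CommRing A] [Algebra ℝ A]
variable {E : Type} [AddCommGroup E] [Module A E] [Module ℝ E] [IsScalarTower ℝ A E]
variable {E' : Type} [AddCommGroup E'] [Module A E'] [Module ℝ E'] [IsScalarTower ℝ A E']
variable {L : Type} [AddCommGroup L] [Module A L] [Module ℝ L] [IsScalarTower ℝ A L]

/-- Pullback of a Courant algebroid structure along a linear isomorphism. -/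
def comap (ca : CourantAlgebroid A E) (Ψ : E' ≃ₗ[A] E) : CourantAlgebroid A E' where
  ip := ca.ip.compl₁₂ Ψ.toLinearMap Ψ.toLinearMap
  rho := ca.rho ∘ₗ Ψ.toLinearMap
  dorf := (ca.dorf.compl₁₂ (Ψ.toLinearMap.restrictScalars ℝ)
      (Ψ.toLinearMap.restrictScalars ℝ)).compr₂
    (Ψ.symm.toLinearMap.restrictScalars ℝ)
  Dmap f := Ψ.symm (ca.Dmap f)
  ip_symm a b := ca.ip_symm _ _
  ip_nondeg := by
    have h : (fun e => ca.ip.compl₁₂ Ψ.toLinearMap Ψ.toLinearMap e)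
        = Ψ.symm.dualMap.symm ∘ (fun e => ca.ip e) ∘ Ψ := by
      funext e
      ext u
      simp [LinearEquiv.dualMap]
    rw [h]
    exact (LinearEquiv.bijective _).comp (ca.ip_nondeg.comp Ψ.bijective)
  ip_D f e := by simp [ca.ip_D]
  rho_D f := by simp [ca.rho_D]
  dorf_jacobi a b c := by
    simp only [LinearMap.compr₂_apply, LinearMap.compl₁₂_apply, LinearMap.restrictScalars_apply,
      LinearEquiv.coe_coe, LinearEquiv.apply_symm_apply]
    rw [ca.dorf_jacobi, map_add]
  rho_dorf a b := by simp [ca.rho_dorf]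
  dorf_leibniz a f b := by simp [ca.dorf_leibniz]
  dorf_sym a b := by
    simp only [LinearMap.compr₂_apply, LinearMap.compl₁₂_apply, LinearMap.restrictScalars_apply,
      LinearEquiv.coe_coe]
    rw [← map_add, ca.dorf_sym]
    exact LinearMap.map_smul_of_tower Ψ.symm.toLinearMap _ _
  dorf_D f e := by simp [ca.dorf_D]
  rho_ip a b c := by simp [ca.rho_ip]

lemma caIsomorphic_comap (ca : CourantAlgebroid A E) (Ψ : E' ≃ₗ[A] E) :
    CAIsomorphic ca (ca.comap Ψ) :=
  ⟨Ψ.symm, by simp [comap], by simp [comap], by simp [comap]⟩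

variable {ca : CourantAlgebroid A E} {Q : QuadLieAlgebroid A L} {κ : Q.Hoist}

namespace Model

variable (m : Model ca Q κ.projector)

/-- The inclusion `F* → E` of a model. -/
noncomputable def dualIncl : Module.Dual A ↥Q.Fq →ₗ[A] E :=
  (2 : ℝ)⁻¹ • ca.sharp.toLinearMap ∘ₗ LinearMap.lcomp A A (Q.anchor.rangeRestrict ∘ₗ m.q)

lemma ip_dualIncl (ξ : Module.Dual A ↥Q.Fq) (u : E) :
    ca.ip (m.dualIncl ξ) u = (2 : ℝ)⁻¹ • ξ (Q.anchor.rangeRestrict (m.q u)) := by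
  rw [dualIncl, LinearMap.smul_apply, LinearMap.map_smul_of_tower, LinearMap.smul_apply]
  simp only [LinearMap.comp_apply, LinearEquiv.coe_coe, ip_sharp, LinearMap.lcomp_apply]

lemma q_dualIncl (ξ : Module.Dual A ↥Q.Fq) : m.q (m.dualIncl ξ) = 0 := by
  rw [m.q_eq_zero]
  intro k hk
  have : Q.anchor.rangeRestrict (m.q k) = 0 := Subtype.ext ((m.anchor_q k).trans hk)
  rw [m.ip_dualIncl, this, map_zero, smul_zero]

/-- The map `F* ⊕ 𝒢 ⊕ F → E` of a model. -/
noncomputable def fromStd : (Module.Dual A ↥Q.Fq × ↥Q.Kq × ↥Q.Fq) →ₗ[A] E :=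
  m.dualIncl ∘ₗ LinearMap.fst A _ _ + m.s ∘ₗ κ.stdProj

lemma fromStd_apply (p : Module.Dual A ↥Q.Fq × ↥Q.Kq × ↥Q.Fq) :
    m.fromStd p = m.dualIncl p.1 + m.s (κ.stdProj p) := rfl

lemma q_fromStd (p : Module.Dual A ↥Q.Fq × ↥Q.Kq × ↥Q.Fq) : m.q (m.fromStd p) = κ.stdProj p := by
  rw [m.fromStd_apply, map_add, m.q_dualIncl, m.q_s, zero_add]

lemma rho_fromStd (p : Module.Dual A ↥Q.Fq × ↥Q.Kq × ↥Q.Fq) : ca.rho (m.fromStd p) = p.2.2 := by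
  rw [← m.anchor_q, m.q_fromStd, κ.anchor_stdProj]

lemma stdProj_sub_projector (p : Module.Dual A ↥Q.Fq × ↥Q.Kq × ↥Q.Fq) :
    κ.stdProj p - κ.projector (κ.stdProj p) = p.2.1 := by
  have : Q.anchor.rangeRestrict (κ.stdProj p) = p.2.2 := Subtype.ext (κ.anchor_stdProj p)
  rw [κ.projector_apply, this, κ.stdProj_apply, add_sub_cancel_right]

lemma ip_fromStd (p p' : Module.Dual A ↥Q.Fq × ↥Q.Kq × ↥Q.Fq) :
    ca.ip (m.fromStd p) (m.fromStd p') =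
      (2:ℝ)⁻¹ • p.1 p'.2.2 + (2:ℝ)⁻¹ • p'.1 p.2.2 + Q.ipG p.2.1 p'.2.1 := by
  have anc : ∀ p : Module.Dual A ↥Q.Fq × ↥Q.Kq × ↥Q.Fq,
      Q.anchor.rangeRestrict (κ.stdProj p) = p.2.2 := fun p => Subtype.ext (κ.anchor_stdProj p)
  rw [m.fromStd_apply p, map_add, LinearMap.add_apply, m.ip_dualIncl, m.q_fromStd, anc,
    ca.ip_symm, m.fromStd_apply p', map_add, LinearMap.add_apply, m.ip_dualIncl, m.q_s, anc,
    ca.ip_symm, m.ip_s_s, stdProj_sub_projector, stdProj_sub_projector]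
  ring

lemma fromStd_bijective : Function.Bijective m.fromStd := by
  constructor
  · rw [← LinearMap.ker_eq_bot, LinearMap.ker_eq_bot']
    intro p hp
    have hq : κ.stdProj p = 0 := by rw [← m.q_fromStd, hp, map_zero]
    have hx : p.2.2 = 0 := Subtype.ext (by rw [← m.rho_fromStd, hp, map_zero]; rfl)
    have hr : p.2.1 = 0 := Subtype.ext (by
      rw [← stdProj_sub_projector, hq, map_zero, sub_zero]; rfl)
    have hξ : p.1 = 0 := by
      ext y
      have h := m.ip_fromStd p (0, 0, y)
      rw [hp] at h
      have := two_mul_half_smul (p.1 y)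
      simp only [map_zero, LinearMap.zero_apply, smul_zero, add_zero, ZeroMemClass.coe_zero] at h
      rw [← h, mul_zero] at this
      exact this.symm
    exact Prod.ext hξ (Prod.ext hr hx)
  · intro e
    refine ⟨((2 : ℝ) • ca.ip (e - m.s (m.q e)) ∘ₗ m.s ∘ₗ κ.toFun,
      ⟨m.q e - κ.projector (m.q e), m.hoist.anchor_sub _⟩, Q.anchor.rangeRestrict (m.q e)), ?_⟩
    have hstd : κ.stdProj ((2 : ℝ) • ca.ip (e - m.s (m.q e)) ∘ₗ m.s ∘ₗ κ.toFun,
        ⟨m.q e - κ.projector (m.q e), m.hoist.anchor_sub _⟩, Q.anchor.rangeRestrict (m.q e))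
        = m.q e := by
      rw [κ.stdProj_apply]
      exact sub_add_cancel _ _
    rw [m.fromStd_apply, hstd, ← eq_sub_iff_add_eq]
    refine ca.ip_ext fun u => ?_
    have hu := m.s_q_sub_mem_perp e _ (m.isIsotropicProjector.rho_sub u)
    rw [map_sub, sub_eq_zero] at hu
    rw [m.ip_dualIncl, hu, m.proj_apply]
    apply two_mul_inj
    rw [two_mul_half_smul, two_mul, ← two_smul ℝ]
    rfl

/-- The isomorphism `F* ⊕ 𝒢 ⊕ F ≅ E` of a model. -/
noncomputable def stdEquiv : (Module.Dual A ↥Q.Fq × ↥Q.Kq × ↥Q.Fq) ≃ₗ[A] E :=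
  LinearEquiv.ofBijective m.fromStd m.fromStd_bijective

lemma stdEquiv_apply (p : Module.Dual A ↥Q.Fq × ↥Q.Kq × ↥Q.Fq) :
    m.stdEquiv p = m.dualIncl p.1 + m.s (κ.stdProj p) := rfl

lemma stdEquiv_zero (r : ↥Q.Kq) (x : ↥Q.Fq) : m.stdEquiv (0, r, x) = m.s (r + κ.toFun x) := by
  rw [m.stdEquiv_apply, map_zero, zero_add, κ.stdProj_apply]

lemma stdProj_stdEquiv_symm (e : E) : κ.stdProj (m.stdEquiv.symm e) = m.q e := by
  rw [← m.q_fromStd]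
  exact congrArg m.q (m.stdEquiv.apply_symm_apply e)

lemma stdEquiv_symm_vert (e : E) :
    ((m.stdEquiv.symm e).2.1 : L) = m.q e - κ.projector (m.q e) := by
  rw [← stdProj_sub_projector, m.stdProj_stdEquiv_symm]

lemma stdEquiv_symm_dual (e : E) (z : ↥Q.Fq) :
    (m.stdEquiv.symm e).1 z = 2 * ca.ip e (m.s (κ.toFun z)) := by
  have h : ca.ip (m.stdEquiv (m.stdEquiv.symm e)) (m.stdEquiv (0, 0, z)) = _ :=
    m.ip_fromStd _ _
  rw [m.stdEquiv.apply_symm_apply, m.stdEquiv_zero] at h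
  simp only [LinearMap.zero_apply, smul_zero, add_zero, ZeroMemClass.coe_zero, map_zero,
    zero_add] at h
  rw [h, two_mul_half_smul]

lemma realizesES {C : L → L → L → A} (H : ∀ x y z, C (κ.toFun x) (κ.toFun y) (κ.toFun z)
      = 2 * ca.tri (m.s (κ.toFun x)) (m.s (κ.toFun y)) (m.s (κ.toFun z))) :
    RealizesES Q C κ (ca.comap m.stdEquiv) := by
  have dorf : ∀ r x r' x', (((ca.comap m.stdEquiv).dorf (0, r, x) (0, r', x')).2.1 : L)
      = Q.bracket (r + κ.toFun x) (r' + κ.toFun x')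
        - κ.projector (Q.bracket (r + κ.toFun x) (r' + κ.toFun x')) := fun r x r' x' => by
    have : (ca.comap m.stdEquiv).dorf (0, r, x) (0, r', x') = m.stdEquiv.symm
      (ca.dorf (m.stdEquiv (0, r, x)) (m.stdEquiv (0, r', x'))) := rfl
    rw [this, m.stdEquiv_symm_vert, m.stdEquiv_zero, m.stdEquiv_zero, m.q_dorf, m.q_s, m.q_s]
  have ker : ∀ X, ∀ r ∈ Q.Kq, Q.bracket X r - κ.projector (Q.bracket X r) = Q.bracket X r :=
    fun X r hr => by rw [m.hoist.apply_of_anchor _ (Q.bracket_mem_ker X hr), sub_zero]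
  refine ⟨⟨m.rho_fromStd, m.ip_fromStd, fun r s => Subtype.ext ?_⟩, fun x r => Subtype.ext ?_,
    fun x y => Subtype.ext ?_, fun x y z => ?_⟩
  · rw [dorf]
    simp only [map_zero, add_zero]
    exact ker _ _ s.2
  · rw [sNabla, dorf]
    simp only [map_zero, add_zero, ZeroMemClass.coe_zero, zero_add]
    exact ker _ _ r.2
  · rw [sR, dorf]
    simp only [ZeroMemClass.coe_zero, zero_add]
    refine congrArg (_ - κ.toFun ·) (Subtype.ext ?_)
    exact (Q.anchor_bracket _ _).trans (by rw [κ.sect, κ.sect]; rfl)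
  · have : sH Q.Fq (ca.comap m.stdEquiv) x y z = (m.stdEquiv.symm
      (ca.dorf (m.stdEquiv (0, 0, x)) (m.stdEquiv (0, 0, y)))).1 z := rfl
    rw [this, m.stdEquiv_symm_dual, m.stdEquiv_zero, m.stdEquiv_zero, H]
    simp [tri]

end Model

end Realization

end CourantAlgebroid

/-! ### The characteristic pair of a regular Courant algebroid -/

namespace CourantAlgebroid

section Ample

variable {A : Type} [CommRing A] [Algebra ℝ A]
variable {E : Type} [AddCommGroup E] [Module A E] [Module ℝ E] [IsScalarTower ℝ A E]
variable {ca : CourantAlgebroid A E}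

/-- The anchor of a regular Courant algebroid has an isotropic section. -/
lemma exists_isotropic_section
    (hreg : ∃ lam : ↥(LinearMap.range ca.rho) →ₗ[A] E, ∀ x, ca.rho (lam x) = ↑x) :
    ∃ μ : ↥(LinearMap.range ca.rho) →ₗ[A] E, (∀ x, ca.rho (μ x) = ↑x) ∧
      ∀ x y, ca.ip (μ x) (μ y) = 0 := by
  obtain ⟨lam, hlam⟩ := hreg
  let τ : ↥(LinearMap.range ca.rho) →ₗ[A] E :=
    ca.sharp.toLinearMap ∘ₗ LinearMap.lcomp A A (lam ∘ₗ ca.rho.rangeRestrict) ∘ₗ ca.ip ∘ₗ lam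
  have hτ : ∀ x u, ca.ip (τ x) u = ca.ip (lam x) (lam (ca.rho.rangeRestrict u)) := fun x u => by
    simp [τ]
  have hrho : ∀ x, ca.rho (τ x) = 0 := fun x => ca.rho_of_mem_perp fun k hk => by
    have : ca.rho.rangeRestrict k = 0 := Subtype.ext hk
    rw [hτ, this, map_zero, map_zero]
  have hττ : ∀ x y, ca.ip (τ x) (τ y) = 0 := fun x y => by
    have : ca.rho.rangeRestrict (τ y) = 0 := Subtype.ext (hrho y)
    rw [hτ, this, map_zero, map_zero]
  have hτl : ∀ x y, ca.ip (τ x) (lam y) = ca.ip (lam x) (lam y) := fun x y => by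
    have : ca.rho.rangeRestrict (lam y) = y := Subtype.ext (hlam y)
    rw [hτ, this]
  refine ⟨lam - (algebraMap ℝ A 2⁻¹) • τ, fun x => ?_, fun x y => ?_⟩
  · simp [hlam, hrho]
  · have h₁ := hτl x y
    have h₂ := hτl y x
    rw [ca.ip_symm, ca.ip_symm (lam y)] at h₂
    simp only [LinearMap.sub_apply, LinearMap.smul_apply, map_sub, map_smul, smul_eq_mul, hττ]
    linear_combination (-algebraMap ℝ A 2⁻¹) * h₁ - algebraMap ℝ A 2⁻¹ * h₂
      - ca.ip (lam x) (lam y) * two_mul_algebraMap_half (A := A)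

variable {P : E →ₗ[A] E}

namespace IsIsotropicProjector

/-- The splitting of `E → E/(ker ρ)⊥` induced by an isotropic projector. -/
noncomputable def ampleSection (hP : ca.IsIsotropicProjector P) : ca.Ample →ₗ[A] E :=
  ca.perp.liftQ (ca.straighten P) fun _ hz => hP.straighten_of_mem_perp hz

lemma ampleSection_qA (hP : ca.IsIsotropicProjector P) (e : E) :
    hP.ampleSection (ca.qA e) = ca.straighten P e := rfl

lemma sub_ampleSection_mem_perp (hP : ca.IsIsotropicProjector P) (e : E) :
    e - hP.ampleSection (ca.qA e) ∈ ca.perp := hP.sub_straighten_mem_perp e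

lemma qA_ampleSection (hP : ca.IsIsotropicProjector P) (X : ca.Ample) :
    ca.qA (hP.ampleSection X) = X := by
  obtain ⟨e, rfl⟩ := ca.perp.mkQ_surjective X
  exact ((Submodule.Quotient.eq _).2 (hP.sub_ampleSection_mem_perp e)).symm

lemma qA_dorf_ampleSection (hP : ca.IsIsotropicProjector P) (e e' : E) :
    ca.qA (ca.dorf (hP.ampleSection (ca.qA e)) (hP.ampleSection (ca.qA e')))
      = ca.qA (ca.dorf e e') := by
  refine ((Submodule.Quotient.eq _).2 ?_).symm
  have h₁ := ca.dorf_left_mem_perp e' (hP.sub_ampleSection_mem_perp e)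
  have h₂ := ca.dorf_right_mem_perp (hP.ampleSection (ca.qA e)) (hP.sub_ampleSection_mem_perp e')
  convert ca.perp.add_mem h₁ h₂ using 1
  simp

lemma ip_ampleSection (hP : ca.IsIsotropicProjector P) (e e' : E) :
    ca.ip (hP.ampleSection (ca.qA e) - P (hP.ampleSection (ca.qA e)))
      (hP.ampleSection (ca.qA e') - P (hP.ampleSection (ca.qA e')))
      = ca.ip (e - P e) (e' - P e') := by
  have hz : ∀ e, hP.ampleSection (ca.qA e) - P (hP.ampleSection (ca.qA e)) - (e - P e)
      ∈ ca.perp := fun e => by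
    have h := hP.sub_ampleSection_mem_perp e
    have h' := hP.apply_of_rho _ (ca.rho_of_mem_perp h)
    rw [map_sub, sub_eq_zero] at h'
    rw [← h', sub_sub_sub_cancel_right]
    rw [← neg_sub]
    exact ca.perp.neg_mem h
  have h₁ := hz e _ (hP.rho_sub (hP.ampleSection (ca.qA e')))
  have h₂ := hz e' _ (hP.rho_sub e)
  rw [ca.ip_symm] at h₂
  rw [map_sub ca.ip, LinearMap.sub_apply] at h₁
  rw [map_sub (ca.ip _) (_ - _)] at h₂
  linear_combination h₁ + h₂

/-- The ample Lie algebroid `E/(ker ρ)⊥`. -/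
noncomputable def ampleAlgebroid (hP : ca.IsIsotropicProjector P) :
    QuadLieAlgebroid A ca.Ample where
  anchor := ca.perp.liftQ ca.rho fun _ hz => ca.rho_of_mem_perp hz
  bracket := (ca.dorf.compl₁₂ (hP.ampleSection.restrictScalars ℝ)
    (hP.ampleSection.restrictScalars ℝ)).compr₂ (ca.qA.restrictScalars ℝ)
  ipG := ca.ip.compl₁₂ ((LinearMap.id - P) ∘ₗ hP.ampleSection)
    ((LinearMap.id - P) ∘ₗ hP.ampleSection)
  bracket_skew X Y := by
    have h := ca.dorf_add_swap_mem_perp (hP.ampleSection X) (hP.ampleSection Y)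
    rw [← Submodule.Quotient.mk_eq_zero, Submodule.Quotient.mk_add] at h
    exact eq_neg_of_add_eq_zero_left h
  jacobi X Y Z := by
    obtain ⟨e, rfl⟩ := ca.perp.mkQ_surjective X
    obtain ⟨e', rfl⟩ := ca.perp.mkQ_surjective Y
    obtain ⟨e'', rfl⟩ := ca.perp.mkQ_surjective Z
    simp only [LinearMap.compr₂_apply, LinearMap.compl₁₂_apply, LinearMap.restrictScalars_apply,
      hP.qA_dorf_ampleSection]
    rw [ca.dorf_jacobi, map_add]
  leibniz X f Y := by
    simp only [LinearMap.compr₂_apply, LinearMap.compl₁₂_apply, LinearMap.restrictScalars_apply,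
      map_smul, ca.dorf_leibniz, map_add, hP.qA_ampleSection]
    rw [add_comm]
    congr 3
    obtain ⟨e, rfl⟩ := ca.perp.mkQ_surjective X
    have := ca.rho_of_mem_perp (hP.sub_ampleSection_mem_perp e)
    rw [map_sub, sub_eq_zero] at this
    exact this.symm
  anchor_bracket X Y := by
    obtain ⟨e, rfl⟩ := ca.perp.mkQ_surjective X
    obtain ⟨e', rfl⟩ := ca.perp.mkQ_surjective Y
    simp only [LinearMap.compr₂_apply, LinearMap.compl₁₂_apply, LinearMap.restrictScalars_apply,
      hP.qA_dorf_ampleSection]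
    exact ca.rho_dorf e e'
  ipG_symm X Y := ca.ip_symm _ _
  ipG_nondeg r hr H := by
    obtain ⟨e, rfl⟩ := ca.perp.mkQ_surjective r
    refine (Submodule.Quotient.mk_eq_zero _).2 fun k hk => ?_
    have h : ca.ip (e - P e) (k - P k) = 0 :=
      (hP.ip_ampleSection e k).symm.trans (H (ca.qA k) hk)
    rwa [hP.apply_of_rho e hr, hP.apply_of_rho k hk, sub_zero, sub_zero] at h
  ipG_inv X r s hr hs := by
    obtain ⟨u, rfl⟩ := ca.perp.mkQ_surjective X
    obtain ⟨e, rfl⟩ := ca.perp.mkQ_surjective r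
    obtain ⟨e', rfl⟩ := ca.perp.mkQ_surjective s
    simp only [LinearMap.compr₂_apply, LinearMap.compl₁₂_apply, LinearMap.restrictScalars_apply,
      hP.qA_dorf_ampleSection]
    simp only [LinearMap.comp_apply, LinearMap.sub_apply, LinearMap.id_apply, hP.ip_ampleSection]
    rw [hP.apply_of_rho e hr, hP.apply_of_rho e' hs,
      hP.apply_of_rho _ (ca.dorf_ker_left_mem_ker u hr),
      hP.apply_of_rho _ (ca.dorf_ker_left_mem_ker u hs)]
    simp only [sub_zero]
    exact ca.rho_ip u e e'

lemma ampleAlgebroid_anchor (hP : ca.IsIsotropicProjector P) (e : E) :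
    hP.ampleAlgebroid.anchor (ca.qA e) = ca.rho e := rfl

lemma ampleAlgebroid_bracket (hP : ca.IsIsotropicProjector P) (e e' : E) :
    hP.ampleAlgebroid.bracket (ca.qA e) (ca.qA e') = ca.qA (ca.dorf e e') :=
  hP.qA_dorf_ampleSection e e'

lemma ampleAlgebroid_ipG (hP : ca.IsIsotropicProjector P) (e e' : E) :
    hP.ampleAlgebroid.ipG (ca.qA e) (ca.qA e') = ca.ip (e - P e) (e' - P e') :=
  hP.ip_ampleSection e e'

lemma rho_ampleSection (hP : ca.IsIsotropicProjector P) (X : ca.Ample) :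
    ca.rho (hP.ampleSection X) = hP.ampleAlgebroid.anchor X := by
  rw [← hP.ampleAlgebroid_anchor, hP.qA_ampleSection]

lemma ampleSection_qA_apply (hP : ca.IsIsotropicProjector P) (e : E) :
    hP.ampleSection (ca.qA (P e)) = P e := by
  rw [hP.ampleSection_qA, hP.straighten_apply_apply]

/-- The model of a Courant algebroid on its ample Lie algebroid. -/
noncomputable def ampleModel (hP : ca.IsIsotropicProjector P) {h : ca.Ample →ₗ[A] ca.Ample}
    (hh : ∀ e, h (ca.qA e) = ca.qA (P e)) : Model ca hP.ampleAlgebroid h where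
  q := ca.qA
  s := hP.ampleSection
  hoist :=
    { anchor_apply := fun X => by
        obtain ⟨e, rfl⟩ := ca.perp.mkQ_surjective X
        rw [hh, hP.ampleAlgebroid_anchor, hP.ampleAlgebroid_anchor, hP.rho_apply]
      apply_of_anchor := fun X hX => by
        obtain ⟨e, rfl⟩ := ca.perp.mkQ_surjective X
        rw [hh, hP.apply_of_rho e hX, map_zero] }
  q_s := hP.qA_ampleSection
  anchor_q := hP.ampleAlgebroid_anchor
  q_eq_zero e := Submodule.Quotient.mk_eq_zero _
  q_dorf e e' := (hP.ampleAlgebroid_bracket e e').symm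
  ip_ker r r' hr hr' := by
    rw [hP.ampleAlgebroid_ipG, hP.apply_of_rho r hr, hP.apply_of_rho r' hr', sub_zero, sub_zero]
  ip_s_hoist X Y := by
    obtain ⟨e, rfl⟩ := ca.perp.mkQ_surjective X
    obtain ⟨e', rfl⟩ := ca.perp.mkQ_surjective Y
    rw [hh, hP.ampleSection_qA_apply]
    exact hP.ip_apply_straighten _ _

end IsIsotropicProjector

/-- The 3-form of a model. -/
def Model.form {L : Type} [AddCommGroup L] [Module A L] [Module ℝ L] [IsScalarTower ℝ A L]
    {Q : QuadLieAlgebroid A L} {h : L →ₗ[A] L} (m : Model ca Q h) (X Y Z : L) : A :=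
  ca.projForm m.proj (m.s X) (m.s Y) (m.s Z)

section Form

variable {L : Type} [AddCommGroup L] [Module A L] [Module ℝ L] [IsScalarTower ℝ A L]
variable {Q : QuadLieAlgebroid A L}

lemma Model.proj_s {h : L →ₗ[A] L} (m : Model ca Q h) (X : L) : m.proj (m.s X) = m.s (h X) := by
  rw [m.proj_apply, m.q_s]

lemma Model.form_hoist {κ : Q.Hoist} (m : Model ca Q κ.projector) (x y z : ↥Q.Fq) :
    m.form (κ.toFun x) (κ.toFun y) (κ.toFun z)
      = 2 * ca.tri (m.s (κ.toFun x)) (m.s (κ.toFun y)) (m.s (κ.toFun z)) := by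
  simp only [Model.form, projForm, m.proj_s, κ.projector_hoist, sub_self, tri, map_zero]
  ring

lemma Model.isKCoherent {κ : Q.Hoist} (m : Model ca Q κ.projector) :
    IsKCoherent Q m.form κ := by
  have hP := m.isIsotropicProjector
  have bk : ∀ X Y Z W, m.form (Q.bracket X Y) Z W
      = ca.projForm m.proj (ca.dorf (m.s X) (m.s Y)) (m.s Z) (m.s W) := fun X Y Z W => by
    have hz := m.s_q_sub_mem_perp (ca.dorf (m.s X) (m.s Y))
    rw [m.q_dorf, m.q_s, m.q_s] at hz
    have h := hP.projForm_of_mem_perp hz (m.s Z) (m.s W)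
    have h' := ca.projForm_add_left (P := m.proj) (ca.dorf (m.s X) (m.s Y) - m.s (Q.bracket X Y))
      (m.s (Q.bracket X Y)) (m.s Z) (m.s W)
    rw [sub_add_cancel, h, zero_add] at h'
    exact h'.symm
  have proj_ker : ∀ r ∈ Q.Kq, m.proj (m.s r) = 0 := fun r hr => by
    rw [m.proj_s, m.hoist.apply_of_anchor r hr, map_zero]
  have dorf_ker : ∀ X, ∀ r ∈ Q.Kq, m.proj (ca.dorf (m.s X) (m.s r)) = 0 := fun X r hr =>
    hP.apply_of_rho _ (ca.dorf_ker_left_mem_ker _ ((m.rho_s r).trans hr))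
  have ker_dorf : ∀ X, ∀ r ∈ Q.Kq, m.proj (ca.dorf (m.s r) (m.s X)) = 0 := fun X r hr => by
    rw [hP.apply_dorf_swap, dorf_ker X r hr, neg_zero]
  have proj_hoist : ∀ x, m.proj (m.s (κ.toFun x)) = m.s (κ.toFun x) := fun x => by
    rw [m.proj_s, κ.projector_hoist]
  refine ⟨fun f X X' Y Z => ?_, fun X Y Z => hP.projForm_swap_left _ _ _,
    fun X Y Z => hP.projForm_swap_right _ _ _, fun X₀ X₁ X₂ X₃ => ?_,
    fun r s t hr hs ht => ?_, fun r s hr hs x => ?_, fun r hr x y => ?_⟩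
  · rw [Model.form, map_add, map_smul, projForm_add_left, hP.projForm_smul_left]
    rfl
  · have h := hP.dCE3_projForm (m.s X₀) (m.s X₁) (m.s X₂) (m.s X₃)
    simp only [dCE3, bk]
    simp only [dCE3, m.rho_s] at h
    exact h
  · have h : Q.ipG (Q.bracket r s) t = ca.tri (m.s r) (m.s s) (m.s t) := by
      rw [tri, m.ip_ker _ _ (ca.dorf_ker_left_mem_ker _ ((m.rho_s s).trans hs))
        ((m.rho_s t).trans ht), m.q_dorf, m.q_s, m.q_s, m.q_s]
    rw [h, Model.form, projForm, proj_ker r hr, proj_ker s hs, proj_ker t ht, dorf_ker r s hs,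
      dorf_ker s t ht, dorf_ker t r hr]
    simp [tri]
  · rw [Model.form, projForm, proj_ker r hr, proj_ker s hs, proj_hoist, dorf_ker r s hs,
      ker_dorf _ s hs, dorf_ker _ r hr]
    simp [tri]
  · have h : Q.ipG r (κ.curv x y) = ca.tri (m.s (κ.toFun x)) (m.s (κ.toFun y)) (m.s r)
        - ca.ip (m.proj (ca.dorf (m.s (κ.toFun x)) (m.s (κ.toFun y)))) (m.s r) := by
      have hq : κ.curv x y = m.q (ca.dorf (m.s (κ.toFun x)) (m.s (κ.toFun y))
          - m.proj (ca.dorf (m.s (κ.toFun x)) (m.s (κ.toFun y)))) := by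
        rw [map_sub, m.q_proj, m.q_dorf, m.q_s, m.q_s, QuadLieAlgebroid.Hoist.curv]
        refine congrArg (_ - κ.toFun ·) (Subtype.ext ?_)
        exact (by rw [Q.anchor_bracket, κ.sect, κ.sect] :
          _ = Q.anchor (Q.bracket (κ.toFun x) (κ.toFun y)))
      have hip := m.ip_ker (ca.dorf (m.s (κ.toFun x)) (m.s (κ.toFun y))
        - m.proj (ca.dorf (m.s (κ.toFun x)) (m.s (κ.toFun y)))) (m.s r) (hP.rho_sub _)
        ((m.rho_s r).trans hr)
      rw [m.q_s] at hip
      rw [hq, Q.ipG_symm, ← hip, map_sub, LinearMap.sub_apply, tri]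
    rw [h, Model.form, projForm, proj_ker r hr, proj_hoist, proj_hoist, ker_dorf _ r hr,
      dorf_ker _ r hr]
    simp [tri]

end Form

lemma IsRegular.nonempty_charRealization (hreg : ca.IsRegular) :
    Nonempty (CharRealization A E ca) := by
  obtain ⟨μ, hμ, hμμ⟩ := exists_isotropic_section hreg.1
  have hP : ca.IsIsotropicProjector (μ ∘ₗ ca.rho.rangeRestrict) :=
    { rho_apply := fun e => hμ _
      apply_of_rho := fun e he => by
        have : ca.rho.rangeRestrict e = 0 := Subtype.ext he
        rw [LinearMap.comp_apply, this, map_zero]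
      isotropic := fun e e' => hμμ _ _ }
  have hle : hP.ampleAlgebroid.Fq ≤ LinearMap.range ca.rho := by
    rintro _ ⟨X, rfl⟩
    exact ⟨_, hP.rho_ampleSection X⟩
  let κ : hP.ampleAlgebroid.Hoist :=
    { toFun := ca.qA ∘ₗ μ ∘ₗ Submodule.inclusion hle
      sect := fun x => hμ _ }
  let m : Model ca hP.ampleAlgebroid κ.projector := hP.ampleModel fun e => rfl
  exact ⟨{
    L := ca.Ample
    Q := hP.ampleAlgebroid
    C := m.form
    κ := κ
    coherent := m.isKCoherent
    ca' := ca.comap m.stdEquiv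
    realizes := m.realizesES m.form_hoist
    iso := ca.caIsomorphic_comap m.stdEquiv }⟩

end Ample

end CourantAlgebroid

open QuadLieAlgebroid in
/-- (1) Equivalence classes of characteristic pairs ↔ isomorphism
classes of regular Courant algebroids (the map `𝔦` is well defined, injective and
surjective); (2) if `E` corresponds to `(𝒜,C)`, the characteristic class of `E`
equals `[C] ∈ H³(𝒜)`. -/
theorem statement18 {A : Type} [CommRing A] [Algebra ℝ A] :
    -- (1) 𝔦 is well defined and injective: two characteristic pairs are equivalent
    --     iff the corresponding standard Courant algebroids are isomorphic
    (∀ (L₁ : Type) [AddCommGroup L₁] [Module A L₁] [Module ℝ L₁] [IsScalarTower ℝ A L₁]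
       (L₂ : Type) [AddCommGroup L₂] [Module A L₂] [Module ℝ L₂] [IsScalarTower ℝ A L₂]
       (Q₁ : QuadLieAlgebroid A L₁) (C₁ : L₁ → L₁ → L₁ → A) (κ₁ : Q₁.Hoist)
       (Q₂ : QuadLieAlgebroid A L₂) (C₂ : L₂ → L₂ → L₂ → A) (κ₂ : Q₂.Hoist),
       IsKCoherent Q₁ C₁ κ₁ → IsKCoherent Q₂ C₂ κ₂ →
       ∀ (ca₁ : CourantAlgebroid A (Module.Dual A ↥Q₁.Fq × ↥Q₁.Kq × ↥Q₁.Fq))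
         (ca₂ : CourantAlgebroid A (Module.Dual A ↥Q₂.Fq × ↥Q₂.Kq × ↥Q₂.Fq)),
         RealizesES Q₁ C₁ κ₁ ca₁ → RealizesES Q₂ C₂ κ₂ ca₂ →
         (PairsEquiv Q₁ C₁ Q₂ C₂ ↔ CAIsomorphic ca₁ ca₂)) ∧
    -- (1) 𝔦 is surjective: every regular Courant algebroid is isomorphic to the
    --     standard Courant algebroid of some characteristic pair
    (∀ (E : Type) [AddCommGroup E] [Module A E] [Module ℝ E] [IsScalarTower ℝ A E]
       (ca : CourantAlgebroid A E), ca.IsRegular →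
       Nonempty (CharRealization A E ca)) ∧
    -- (2) if E corresponds to the characteristic pair (𝒜,C), then for any dissection Ψ
    --     of E the naive 3-cocycle C_Ψ differs from (the pullback to E of) C by a naive
    --     coboundary: the characteristic class of E equals [C] ∈ H³(𝒜)
    (∀ (E : Type) [AddCommGroup E] [Module A E] [Module ℝ E] [IsScalarTower ℝ A E]
       (ca : CourantAlgebroid A E), ca.IsRegular →
       ∀ (L : Type) [AddCommGroup L] [Module A L] [Module ℝ L] [IsScalarTower ℝ A L]
         (Q : QuadLieAlgebroid A L) (C : L → L → L → A) (κ : Q.Hoist),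
         IsKCoherent Q C κ →
       ∀ ca' : CourantAlgebroid A (Module.Dual A ↥Q.Fq × ↥Q.Kq × ↥Q.Fq),
         RealizesES Q C κ ca' →
       ∀ Θ : E ≃ₗ[A] (Module.Dual A ↥Q.Fq × ↥Q.Kq × ↥Q.Fq),
         (∀ p, ca'.rho (Θ p) = ca.rho p) →
         (∀ p q, ca'.ip (Θ p) (Θ q) = ca.ip p q) →
         (∀ p q, Θ (ca.dorf p q) = ca'.dorf (Θ p) (Θ q)) →
       ∀ d : Dissection Q.Fq (fun r s => lGk (Q := Q) r s) (fun r s => Q.ipG ↑r ↑s) ca,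
         ∃ φ : E → E → A,
           (∀ e₁ e₂, φ e₁ e₂ = - φ e₂ e₁) ∧
           (∀ (f : A) e₁ e₁' e₂, φ (f • e₁ + e₁') e₂ = f * φ e₁ e₂ + φ e₁' e₂) ∧
           (∀ e₁ e₂, e₁ ∈ ca.perp → φ e₁ e₂ = 0) ∧
           (∀ e₀ e₁ e₂,
             d.Cform e₀ e₁ e₂
               - C (↑((Θ e₀).2.1) + κ.toFun (Θ e₀).2.2)
                   (↑((Θ e₁).2.1) + κ.toFun (Θ e₁).2.2)
                   (↑((Θ e₂).2.1) + κ.toFun (Θ e₂).2.2)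
               = dCE2 (fun e f => ca.rho e f) (courantBk ca) φ e₀ e₁ e₂)) := by
  refine ⟨?_, ?_, ?_⟩
  · intro L₁ _ _ _ _ L₂ _ _ _ _ Q₁ C₁ κ₁ Q₂ C₂ κ₂ hC₁ hC₂ ca₁ ca₂ hR₁ hR₂
    refine ⟨fun e => hR₁.model.caIsomorphic_of_pairsEquiv hR₂.model hC₁.isCoherentForm
      hC₂.isCoherentForm hR₁.form_hoist hR₂.form_hoist e, ?_⟩
    rintro ⟨Θ, hrho, hip, hdorf⟩
    exact hR₁.model.pairsEquiv (hR₂.model.pullback Θ hrho hip hdorf)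
      (hR₁.model.form_eq_projForm hC₁.isCoherentForm hR₁.form_hoist)
      (hR₂.model.form_eq_projForm_pullback hrho hip hdorf hC₂.isCoherentForm hR₂.form_hoist)
  · intro E _ _ _ _ ca hreg
    exact hreg.nonempty_charRealization
  · intro E _ _ _ _ ca hreg L _ _ _ _ Q C κ hC ca' hR Θ hrho hip hdorf d
    have hP := d.isIsotropicProjector
    have hP' := (hR.model.pullback Θ hrho hip hdorf).isIsotropicProjector
    refine ⟨ca.skewForm (d.proj - (hR.model.pullback Θ hrho hip hdorf).proj), ca.skewForm_swap _,
      ca.skewForm_smul_add _, fun e₁ e₂ he => hP.skewForm_sub_of_mem_perp hP' he e₂,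
      fun e₀ e₁ e₂ => ?_⟩
    rw [d.Cform_eq_projForm]
    refine Eq.trans (congrArg (ca.projForm d.proj e₀ e₁ e₂ - ·) ?_)
      (hP'.projForm_sub_projForm_naive hP e₀ e₁ e₂)
    exact hR.model.form_eq_projForm_pullback hrho hip hdorf hC.isCoherentForm hR.form_hoist
      e₀ e₁ e₂
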